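/- arXiv:1808.00517 — 2 statements merged into one kernel-verified Lean document; each statement's English description precedes it below -/
import Mathlib

section
/- Let P(λ) = Σ_{i=0}^k λ^i A_i be an m×n matrix polynomial of grade k with m ≥ n, and let L(λ) ∈ 𝕃₁(P) with nonzero right ansatz vector v ∈ F^k have full Z-rank. Let r = nrank P(λ), c = (k−1)(m−n), and define 𝓛_v : N_l(L) → N_l(P) by 𝓛_v(y(λ)) = (v^T⊗I_m)y(λ). Then there exists a minimal basis of N_l(L) of the form {y₁(λ), …, y_{m−r}(λ), u_{m−r+1}, …, u_{m−r+c}}, where u_{m−r+1}, …, u_{m−r+c} ∈ F^{km} are constant vectors forming a basis of the kernel of 𝓛_v. -/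
noncomputable section

open Polynomial Matrix

namespace GLin

variable {F : Type*} [RCLike F]

/-! ### Matrix polynomials and pencils -/

/-- The matrix polynomial `P(λ) = ∑_{i=0}^k λ^i A_i` determined by its
coefficient matrices `A_0, …, A_k` (grade `k`). -/
def matPoly {k m n : ℕ} (A : Fin (k + 1) → Matrix (Fin m) (Fin n) F) :
    Matrix (Fin m) (Fin n) F[X] :=
  Matrix.of fun r c => ∑ i : Fin (k + 1), Polynomial.C (A i r c) * Polynomial.X ^ (i : ℕ)

/-- The matrix pencil `L(λ) = λ X + Y`. -/
def pencil {ρ γ : Type*} (Xc Yc : Matrix ρ γ F) : Matrix ρ γ F[X] :=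
  Matrix.of fun i j => Polynomial.C (Xc i j) * Polynomial.X + Polynomial.C (Yc i j)

/-- `Λ_k(λ) ⊗ I_n` where `Λ_k(λ) = (λ^{k-1}, …, λ, 1)ᵀ`. -/
def Lam (F : Type*) [RCLike F] (k n : ℕ) : Matrix (Fin k × Fin n) (Fin n) F[X] :=
  Matrix.of fun p c => if p.2 = c then Polynomial.X ^ (k - 1 - (p.1 : ℕ)) else 0

/-- `Λ_k(λ)ᵀ ⊗ I_m`. -/
def LamRow (F : Type*) [RCLike F] (k m : ℕ) : Matrix (Fin m) (Fin k × Fin m) F[X] :=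
  Matrix.of fun r p => if r = p.2 then Polynomial.X ^ (k - 1 - (p.1 : ℕ)) else 0

/-- `v ⊗ P(λ)`. -/
def vkron {k m n : ℕ} (v : Fin k → F) (P : Matrix (Fin m) (Fin n) F[X]) :
    Matrix (Fin k × Fin m) (Fin n) F[X] :=
  Matrix.of fun p c => Polynomial.C (v p.1) * P p.2 c

/-- `wᵀ ⊗ P(λ)`. -/
def wkron {k m n : ℕ} (w : Fin k → F) (P : Matrix (Fin m) (Fin n) F[X]) :
    Matrix (Fin m) (Fin k × Fin n) F[X] :=
  Matrix.of fun r q => Polynomial.C (w q.1) * P r q.2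

/-- The defining identity of `𝕃₁(P)`: `L(λ)(Λ_k(λ) ⊗ I_n) = v ⊗ P(λ)`. -/
def RightAnsatz {k m n : ℕ} (P : Matrix (Fin m) (Fin n) F[X])
    (L : Matrix (Fin k × Fin m) (Fin k × Fin n) F[X]) (v : Fin k → F) : Prop :=
  L * Lam F k n = vkron v P

/-- The defining identity of `𝕃₂(P)`: `(Λ_k(λ)ᵀ ⊗ I_m) L(λ) = wᵀ ⊗ P(λ)`. -/
def LeftAnsatz {k m n : ℕ} (P : Matrix (Fin m) (Fin n) F[X])
    (L : Matrix (Fin k × Fin m) (Fin k × Fin n) F[X]) (w : Fin k → F) : Prop :=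
  LamRow F k m * L = wkron w P

/-- The vector `α e₁ ∈ F^k`. -/
def e1 {k : ℕ} (α : F) : Fin k → F := fun i => if (i : ℕ) = 0 then α else 0

/-- `M ⊗ I_m`. -/
def kronId {k m : ℕ} (M : Matrix (Fin k) (Fin k) F) :
    Matrix (Fin k × Fin m) (Fin k × Fin m) F :=
  Matrix.of fun p q => if p.2 = q.2 then M p.1 q.1 else 0

/-! ### (strong) g-linearizations -/

/-- `diag(P(λ), I_{k-1} ⊗ I_{m,n})`. -/
def glinTarget {k m n : ℕ} (P : Matrix (Fin m) (Fin n) F[X]) :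
    Matrix (Fin k × Fin m) (Fin k × Fin n) F[X] :=
  Matrix.of fun p q =>
    if p.1 = q.1 then
      (if (p.1 : ℕ) = 0 then P p.2 q.2 else if (p.2 : ℕ) = (q.2 : ℕ) then 1 else 0)
    else 0

/-- A `km × kn` pencil (or matrix polynomial) `L` is a g-linearization of the `m × n`
matrix polynomial `P` of grade `k` if `E(λ) L(λ) G(λ) = diag(P(λ), I_{k-1} ⊗ I_{m,n})`
for unimodular `E`, `G`. -/
def IsGLin {k m n : ℕ} (P : Matrix (Fin m) (Fin n) F[X])
    (L : Matrix (Fin k × Fin m) (Fin k × Fin n) F[X]) : Prop :=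
  ∃ (E : Matrix (Fin k × Fin m) (Fin k × Fin m) F[X])
    (G : Matrix (Fin k × Fin n) (Fin k × Fin n) F[X]),
      IsUnit E.det ∧ IsUnit G.det ∧ E * L * G = glinTarget P

/-- grade-`N` reversal `rev_N P(λ) = λ^N P(1/λ)`, entrywise. -/
def revMat {ρ γ : Type*} (N : ℕ) (P : Matrix ρ γ F[X]) : Matrix ρ γ F[X] :=
  P.map fun p => Polynomial.reflect N p

/-- Strong g-linearization of the grade-`k` matrix polynomial with coefficients `A`. -/
def IsStrongGLin {k m n : ℕ} (A : Fin (k + 1) → Matrix (Fin m) (Fin n) F)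
    (L : Matrix (Fin k × Fin m) (Fin k × Fin n) F[X]) : Prop :=
  IsGLin (matPoly A) L ∧ IsGLin (revMat k (matPoly A)) (revMat 1 L)

/-! ### linearizations (rectangular, of size `(m+s) × (n+s)`) -/

/-- A matrix polynomial `L` (indexed by arbitrary finite types of cardinalities
`m + s` and `n + s`) is a linearization of `P` if, after identifying the index types
with `Fin m ⊕ Fin s` and `Fin n ⊕ Fin s`, one has `E(λ) L(λ) G(λ) = diag(P(λ), I_s)`
for unimodular `E`, `G`. -/
def IsLin {m n : ℕ} (s : ℕ) (P : Matrix (Fin m) (Fin n) F[X])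
    {ρ γ : Type*} [Fintype ρ] [DecidableEq ρ] [Fintype γ] [DecidableEq γ]
    (L : Matrix ρ γ F[X]) : Prop :=
  ∃ (er : ρ ≃ (Fin m ⊕ Fin s)) (ec : γ ≃ (Fin n ⊕ Fin s))
    (E : Matrix (Fin m ⊕ Fin s) (Fin m ⊕ Fin s) F[X])
    (G : Matrix (Fin n ⊕ Fin s) (Fin n ⊕ Fin s) F[X]),
      IsUnit E.det ∧ IsUnit G.det ∧
        E * Matrix.reindex er ec L * G = Matrix.fromBlocks P 0 0 1

/-- Strong linearization of the grade-`k` matrix polynomial with coefficients `A`. -/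
def IsStrongLin {k m n : ℕ} (s : ℕ) (A : Fin (k + 1) → Matrix (Fin m) (Fin n) F)
    {ρ γ : Type*} [Fintype ρ] [DecidableEq ρ] [Fintype γ] [DecidableEq γ]
    (L : Matrix ρ γ F[X]) : Prop :=
  IsLin s (matPoly A) L ∧ IsLin s (revMat k (matPoly A)) (revMat 1 L)

/-! ### shifted sums -/

/-- Column shifted sum `X ⊞→ Y`. -/
def colShiftSum {k m n : ℕ} (Xc Yc : Matrix (Fin k × Fin m) (Fin k × Fin n) F) :
    Matrix (Fin k × Fin m) (Fin (k + 1) × Fin n) F :=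
  Matrix.of fun p q =>
    (if h : (q.1 : ℕ) < k then Xc p (⟨(q.1 : ℕ), h⟩, q.2) else 0) +
    (if h : 0 < (q.1 : ℕ) then
        Yc p (⟨(q.1 : ℕ) - 1, by have := q.1.isLt; omega⟩, q.2)
      else 0)

/-- Row shifted sum `X ⊞↓ Y`. -/
def rowShiftSum {k m n : ℕ} (Xc Yc : Matrix (Fin k × Fin m) (Fin k × Fin n) F) :
    Matrix (Fin (k + 1) × Fin m) (Fin k × Fin n) F :=
  Matrix.of fun p q =>
    (if h : (p.1 : ℕ) < k then Xc (⟨(p.1 : ℕ), h⟩, p.2) q else 0) +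
    (if h : 0 < (p.1 : ℕ) then
        Yc (⟨(p.1 : ℕ) - 1, by have := p.1.isLt; omega⟩, p.2) q
      else 0)

/-! ### the parametrization of `𝕃₁(P)` and `𝕃₂(P)` -/

/-- `X = [v ⊗ A_k ∣ -W]`. -/
def L1X {k m n : ℕ} (A : Fin (k + 1) → Matrix (Fin m) (Fin n) F) (v : Fin k → F)
    (W : Matrix (Fin k × Fin m) (Fin (k - 1) × Fin n) F) :
    Matrix (Fin k × Fin m) (Fin k × Fin n) F :=
  Matrix.of fun p q =>
    if h : (q.1 : ℕ) = 0 then v p.1 * A (Fin.last k) p.2 q.2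
    else -W p (⟨(q.1 : ℕ) - 1, by have := q.1.isLt; omega⟩, q.2)

/-- `Y = [W + v ⊗ [A_{k-1} ⋯ A_1] ∣ v ⊗ A_0]`. -/
def L1Y {k m n : ℕ} (A : Fin (k + 1) → Matrix (Fin m) (Fin n) F) (v : Fin k → F)
    (W : Matrix (Fin k × Fin m) (Fin (k - 1) × Fin n) F) :
    Matrix (Fin k × Fin m) (Fin k × Fin n) F :=
  Matrix.of fun p q =>
    if h : (q.1 : ℕ) < k - 1 then
      W p (⟨(q.1 : ℕ), h⟩, q.2) + v p.1 * A (⟨k - 1 - (q.1 : ℕ), by omega⟩) p.2 q.2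
    else v p.1 * A 0 p.2 q.2

/-- `X = [wᵀ ⊗ A_k ; -Ŵ]`. -/
def L2X {k m n : ℕ} (A : Fin (k + 1) → Matrix (Fin m) (Fin n) F) (w : Fin k → F)
    (W : Matrix (Fin (k - 1) × Fin m) (Fin k × Fin n) F) :
    Matrix (Fin k × Fin m) (Fin k × Fin n) F :=
  Matrix.of fun p q =>
    if h : (p.1 : ℕ) = 0 then w q.1 * A (Fin.last k) p.2 q.2
    else -W (⟨(p.1 : ℕ) - 1, by have := p.1.isLt; omega⟩, p.2) q

/-- `Y = [Ŵ + wᵀ ⊗ [A_{k-1}ᵀ ⋯ A_1ᵀ]ᵀ ; wᵀ ⊗ A_0]`. -/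
def L2Y {k m n : ℕ} (A : Fin (k + 1) → Matrix (Fin m) (Fin n) F) (w : Fin k → F)
    (W : Matrix (Fin (k - 1) × Fin m) (Fin k × Fin n) F) :
    Matrix (Fin k × Fin m) (Fin k × Fin n) F :=
  Matrix.of fun p q =>
    if h : (p.1 : ℕ) < k - 1 then
      W (⟨(p.1 : ℕ), h⟩, p.2) q + w q.1 * A (⟨k - 1 - (p.1 : ℕ), by omega⟩) p.2 q.2
    else w q.1 * A 0 p.2 q.2

/-! ### block structure and `Z`-matrices -/

/-- Assemble a `km × kn` matrix from blocks with row split `m + (k-1)m` and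
column split `n + (k-1)n`. -/
def blk {k m n : ℕ} (TL : Matrix (Fin m) (Fin n) F)
    (TR : Matrix (Fin m) (Fin (k - 1) × Fin n) F)
    (BL : Matrix (Fin (k - 1) × Fin m) (Fin n) F)
    (BR : Matrix (Fin (k - 1) × Fin m) (Fin (k - 1) × Fin n) F) :
    Matrix (Fin k × Fin m) (Fin k × Fin n) F :=
  Matrix.of fun p q =>
    if hp : (p.1 : ℕ) = 0 then
      if hq : (q.1 : ℕ) = 0 then TL p.2 q.2
      else TR p.2 (⟨(q.1 : ℕ) - 1, by have := q.1.isLt; omega⟩, q.2)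
    else
      if hq : (q.1 : ℕ) = 0 then
        BL (⟨(p.1 : ℕ) - 1, by have := p.1.isLt; omega⟩, p.2) q.2
      else
        BR (⟨(p.1 : ℕ) - 1, by have := p.1.isLt; omega⟩, p.2)
          (⟨(q.1 : ℕ) - 1, by have := q.1.isLt; omega⟩, q.2)

/-- Assemble `[[Y₁₁, T],[Z, 0]]`, row split `m + (k-1)m`, column split `(k-1)n + n`. -/
def blkY1 {k m n : ℕ} (Y11 : Matrix (Fin m) (Fin (k - 1) × Fin n) F)
    (T : Matrix (Fin m) (Fin n) F)
    (Z : Matrix (Fin (k - 1) × Fin m) (Fin (k - 1) × Fin n) F) :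
    Matrix (Fin k × Fin m) (Fin k × Fin n) F :=
  Matrix.of fun p q =>
    if hp : (p.1 : ℕ) = 0 then
      if hq : (q.1 : ℕ) < k - 1 then Y11 p.2 (⟨(q.1 : ℕ), hq⟩, q.2) else T p.2 q.2
    else
      if hq : (q.1 : ℕ) < k - 1 then
        Z (⟨(p.1 : ℕ) - 1, by have := p.1.isLt; omega⟩, p.2) (⟨(q.1 : ℕ), hq⟩, q.2)
      else 0

/-- Assemble `[[Y₁₁, Z],[T, 0]]`, row split `(k-1)m + m`, column split `n + (k-1)n`. -/
def blkY2 {k m n : ℕ} (Y11 : Matrix (Fin (k - 1) × Fin m) (Fin n) F)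
    (Z : Matrix (Fin (k - 1) × Fin m) (Fin (k - 1) × Fin n) F)
    (T : Matrix (Fin m) (Fin n) F) :
    Matrix (Fin k × Fin m) (Fin k × Fin n) F :=
  Matrix.of fun p q =>
    if hp : (p.1 : ℕ) < k - 1 then
      if hq : (q.1 : ℕ) = 0 then Y11 (⟨(p.1 : ℕ), hp⟩, p.2) q.2
      else Z (⟨(p.1 : ℕ), hp⟩, p.2) (⟨(q.1 : ℕ) - 1, by have := q.1.isLt; omega⟩, q.2)
    else
      if hq : (q.1 : ℕ) = 0 then T p.2 q.2 else 0

/-- The `Z`-matrix of `L = λX + Y ∈ 𝕃₁(P)` with respect to `M`: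
the lower-left `(k-1)m × (k-1)n` block of `(M ⊗ I_m) Y`. -/
def Zmat1 {k m n : ℕ} (M : Matrix (Fin k) (Fin k) F)
    (Yc : Matrix (Fin k × Fin m) (Fin k × Fin n) F) :
    Matrix (Fin (k - 1) × Fin m) (Fin (k - 1) × Fin n) F :=
  Matrix.of fun p q =>
    (kronId M * Yc : Matrix (Fin k × Fin m) (Fin k × Fin n) F)
      (⟨(p.1 : ℕ) + 1, by have := p.1.isLt; omega⟩, p.2)
      (⟨(q.1 : ℕ), by have := q.1.isLt; omega⟩, q.2)

/-- The `Z`-matrix of `L = λX + Y ∈ 𝕃₂(P)` with respect to `M̂`: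
the upper-right `(k-1)m × (k-1)n` block of `Y (M̂ᵀ ⊗ I_n)`. -/
def Zmat2 {k m n : ℕ} (M : Matrix (Fin k) (Fin k) F)
    (Yc : Matrix (Fin k × Fin m) (Fin k × Fin n) F) :
    Matrix (Fin (k - 1) × Fin m) (Fin (k - 1) × Fin n) F :=
  Matrix.of fun p q =>
    (Yc * kronId Mᵀ : Matrix (Fin k × Fin m) (Fin k × Fin n) F)
      (⟨(p.1 : ℕ), by have := p.1.isLt; omega⟩, p.2)
      (⟨(q.1 : ℕ) + 1, by have := q.1.isLt; omega⟩, q.2)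

/-- `L = λX + Y ∈ 𝕃₁(P)` with right ansatz vector `v` has full `Z`-rank. -/
def FullZrank1 {k m n : ℕ} (Yc : Matrix (Fin k × Fin m) (Fin k × Fin n) F)
    (v : Fin k → F) : Prop :=
  ∃ (M : Matrix (Fin k) (Fin k) F) (α : F),
    IsUnit M ∧ α ≠ 0 ∧ M.mulVec v = e1 α ∧ (Zmat1 M Yc).rank = (k - 1) * n

/-- `L = λX + Y ∈ 𝕃₂(P)` with left ansatz vector `w` has full `Z`-rank. -/
def FullZrank2 {k m n : ℕ} (Yc : Matrix (Fin k × Fin m) (Fin k × Fin n) F)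
    (w : Fin k → F) : Prop :=
  ∃ (M : Matrix (Fin k) (Fin k) F) (α : F),
    IsUnit M ∧ α ≠ 0 ∧ M.mulVec w = e1 α ∧ (Zmat2 M Yc).rank = (k - 1) * m

/-! ### null spaces, minimal bases and minimal indices over `F(λ)` -/

/-- A matrix polynomial viewed as a matrix over the field of rational functions. -/
def matRF {ρ γ : Type*} (P : Matrix ρ γ F[X]) : Matrix ρ γ (RatFunc F) :=
  P.map (algebraMap F[X] (RatFunc F))

/-- The right null space `N_r(P) = {x(λ) : P(λ) x(λ) ≡ 0}` over `F(λ)`. -/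
def Nr {ρ γ : Type*} [Fintype γ] (P : Matrix ρ γ F[X]) :
    Submodule (RatFunc F) (γ → RatFunc F) :=
  LinearMap.ker (Matrix.mulVecLin (matRF P))

/-- The left null space `N_l(P) = {y(λ) : y(λ)ᵀ P(λ) ≡ 0}` over `F(λ)`. -/
def Nl {ρ γ : Type*} [Fintype ρ] (P : Matrix ρ γ F[X]) :
    Submodule (RatFunc F) (ρ → RatFunc F) :=
  Nr Pᵀ

/-- The normal rank of a matrix polynomial: its rank over `F(λ)`. -/
def nrank {ρ γ : Type*} [Fintype γ] (P : Matrix ρ γ F[X]) : ℕ :=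
  (matRF P).rank

/-- The rational vector determined by a vector polynomial. -/
def polyVec {γ : Type*} (x : γ → F[X]) : γ → RatFunc F :=
  fun i => algebraMap F[X] (RatFunc F) (x i)

/-- A rational vector is a vector polynomial if all its entries are polynomials. -/
def IsVecPoly {γ : Type*} (x : γ → RatFunc F) : Prop :=
  ∃ p : γ → F[X], x = polyVec p

/-- The degree of a vector polynomial: the greatest degree of its components. -/
def polyVecDeg {γ : Type*} [Fintype γ] (x : γ → F[X]) : ℕ :=
  Finset.univ.sup fun i => (x i).natDegree

/-- A polynomial basis of the subspace `V` of `F(λ)^γ`. -/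
def IsPolyBasis {γ ι : Type*} [Fintype γ]
    (V : Submodule (RatFunc F) (γ → RatFunc F)) (b : ι → γ → F[X]) : Prop :=
  LinearIndependent (RatFunc F) (fun i => polyVec (b i)) ∧
    Submodule.span (RatFunc F) (Set.range fun i => polyVec (b i)) = V

/-- A minimal basis of `V`: a polynomial basis of least order (sum of degrees). -/
def IsMinimalBasis {γ ι : Type*} [Fintype γ] [Fintype ι]
    (V : Submodule (RatFunc F) (γ → RatFunc F)) (b : ι → γ → F[X]) : Prop :=
  IsPolyBasis V b ∧
    ∀ (d : ℕ) (b' : Fin d → γ → F[X]), IsPolyBasis V b' →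
      ∑ i, polyVecDeg (b i) ≤ ∑ i, polyVecDeg (b' i)

/-- `ε` is the list of minimal indices of `V`: some minimal basis of `V` has
`ε` as its list of degrees. -/
def HasMinIndices {γ : Type*} [Fintype γ]
    (V : Submodule (RatFunc F) (γ → RatFunc F)) {d : ℕ} (ε : Fin d → ℕ) : Prop :=
  ∃ b : Fin d → γ → F[X], IsMinimalBasis V b ∧ ∀ i, polyVecDeg (b i) = ε i

/-- `Λ_k(λ) ⊗ x(λ)`. -/
def lamTensor {n : ℕ} (k : ℕ) (x : Fin n → RatFunc F) : Fin k × Fin n → RatFunc F :=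
  fun p => algebraMap F[X] (RatFunc F) (Polynomial.X ^ (k - 1 - (p.1 : ℕ))) * x p.2

/-- The matrix `vᵀ ⊗ I_m` over `F(λ)`; `𝓛_v(y) = (vproj v).mulVec y`. -/
def vproj {k m : ℕ} (v : Fin k → F) : Matrix (Fin m) (Fin k × Fin m) (RatFunc F) :=
  Matrix.of fun r p =>
    if r = p.2 then algebraMap F[X] (RatFunc F) (Polynomial.C (v p.1)) else 0

/-- `(vᵀ ⊗ I_m) y` at the level of vector polynomials. -/
def LvPoly {k m : ℕ} (v : Fin k → F) (y : Fin k × Fin m → F[X]) : Fin m → F[X] :=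
  fun r => ∑ i : Fin k, Polynomial.C (v i) * y (i, r)

/-- The rational subspace spanned by the rows of a matrix polynomial. -/
def rowSpan {ρ γ : Type*} [Fintype γ] (B : Matrix ρ γ F[X]) :
    Submodule (RatFunc F) (γ → RatFunc F) :=
  Submodule.span (RatFunc F) (Set.range fun i => polyVec (B i))

/-- A matrix polynomial is a minimal basis if its rows form a minimal basis of the
rational subspace they span. -/
def IsMinimalBasisMat {ρ γ : Type*} [Fintype ρ] [Fintype γ] (B : Matrix ρ γ F[X]) : Prop :=
  IsMinimalBasis (rowSpan B) (fun i => B i)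

/-- Dual minimal bases: `B ∈ F[λ]^{n₁×n}`, `C ∈ F[λ]^{n₂×n}` minimal bases with
`n₁ + n₂ = n` and `B Cᵀ = 0`. -/
def DualMinBases {ρ ρ' γ : Type*} [Fintype ρ] [Fintype ρ'] [Fintype γ]
    (B : Matrix ρ γ F[X]) (Cm : Matrix ρ' γ F[X]) : Prop :=
  IsMinimalBasisMat B ∧ IsMinimalBasisMat Cm ∧
    Fintype.card ρ + Fintype.card ρ' = Fintype.card γ ∧ B * Cmᵀ = 0

/-! ### norms, singular values -/

/-- Square of the Frobenius norm of a constant matrix. -/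
def frobSq {ρ γ : Type*} [Fintype ρ] [Fintype γ] (Ac : Matrix ρ γ F) : ℝ :=
  ∑ i, ∑ j, ‖Ac i j‖ ^ 2

/-- `‖λX + Y‖_F = sqrt(‖X‖_F² + ‖Y‖_F²)`. -/
def penFrob {ρ γ : Type*} [Fintype ρ] [Fintype γ] (Xc Yc : Matrix ρ γ F) : ℝ :=
  Real.sqrt (frobSq Xc + frobSq Yc)

/-- `‖P‖_F = sqrt(∑ ‖A_i‖_F²)` for `P(λ) = ∑ λ^i A_i`. -/
def famFrob {k m n : ℕ} (A : Fin (k + 1) → Matrix (Fin m) (Fin n) F) : ℝ :=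
  Real.sqrt (∑ i, frobSq (A i))

/-- `‖P‖_F` for a matrix polynomial of grade `g`. -/
def mpolyFrob {ρ γ : Type*} [Fintype ρ] [Fintype γ] (g : ℕ) (P : Matrix ρ γ F[X]) : ℝ :=
  Real.sqrt (∑ i, ∑ j, ∑ d ∈ Finset.range (g + 1), ‖(P i j).coeff d‖ ^ 2)

/-- Square of the Euclidean norm of a vector. -/
def vecNormSq {ι : Type*} [Fintype ι] (x : ι → F) : ℝ := ∑ i, ‖x i‖ ^ 2

/-- The smallest singular value of a matrix. -/
def sigmaMin {ρ γ : Type*} [Fintype ρ] [Fintype γ] (Ac : Matrix ρ γ F) : ℝ :=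
  if Fintype.card γ ≤ Fintype.card ρ then
    sInf {r : ℝ | ∃ x : γ → F, vecNormSq x = 1 ∧ r = Real.sqrt (vecNormSq (Ac.mulVec x))}
  else
    sInf {r : ℝ | ∃ y : ρ → F, vecNormSq y = 1 ∧ r = Real.sqrt (vecNormSq (Acᴴ.mulVec y))}

/-- The spectral norm (2-norm) of a matrix. -/
def norm2 {ρ γ : Type*} [Fintype ρ] [Fintype γ] (Ac : Matrix ρ γ F) : ℝ :=
  sSup {r : ℝ | ∃ x : γ → F, vecNormSq x = 1 ∧ r = Real.sqrt (vecNormSq (Ac.mulVec x))}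

/-- `κ₂(D) = ‖D‖₂ ‖D⁻¹‖₂`. -/
def cond2 {ρ : Type*} [Fintype ρ] [DecidableEq ρ] (Dc : Matrix ρ ρ F) : ℝ :=
  norm2 Dc * norm2 Dc⁻¹

/-! ### pencils used in the backward error analysis -/

/-- `B(λ) = λ [0 ∣ -R̃] + [R̃ ∣ 0]`, i.e. `R̃ (H_{k-1}(λ) ⊗ I_n)` up to sign conventions. -/
def Bpencil {k n : ℕ} (R : Matrix (Fin (k - 1) × Fin n) (Fin (k - 1) × Fin n) F) :
    Matrix (Fin (k - 1) × Fin n) (Fin k × Fin n) F[X] :=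
  Matrix.of fun p q =>
    (if h : (q.1 : ℕ) < k - 1 then Polynomial.C (R p (⟨(q.1 : ℕ), h⟩, q.2)) else 0) +
    (if h : 0 < (q.1 : ℕ) then
        Polynomial.X *
          Polynomial.C (-R p (⟨(q.1 : ℕ) - 1, by have := q.1.isLt; omega⟩, q.2))
      else 0)

/-- The coefficient of `λ` in `H_{k-1}(λ) ⊗ I_n`. -/
def Hlam (F : Type*) [RCLike F] (k n : ℕ) :
    Matrix (Fin (k - 1) × Fin n) (Fin k × Fin n) F :=
  Matrix.of fun p q => if p.2 = q.2 ∧ (q.1 : ℕ) = (p.1 : ℕ) + 1 then 1 else 0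

/-- The constant coefficient of `H_{k-1}(λ) ⊗ I_n`. -/
def Hconst (F : Type*) [RCLike F] (k n : ℕ) :
    Matrix (Fin (k - 1) × Fin n) (Fin k × Fin n) F :=
  Matrix.of fun p q => if p.2 = q.2 ∧ (q.1 : ℕ) = (p.1 : ℕ) then -1 else 0

/-- The convolution matrix `C_j(λ Xc + Yc)` of a pencil, with `j+1` block columns. -/
def convPencil {ρ γ : Type*} (Xc Yc : Matrix ρ γ F) (j : ℕ) :
    Matrix (Fin (j + 2) × ρ) (Fin (j + 1) × γ) F :=
  Matrix.of fun r c =>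
    if (r.1 : ℕ) = (c.1 : ℕ) then Xc r.2 c.2
    else if (r.1 : ℕ) = (c.1 : ℕ) + 1 then Yc r.2 c.2 else 0

/-- λ-coefficient of the trimmed pencil `L̂_t(λ)`:
`[[α A_k, X₁₂],[0, -R̃]]` with row split `m + (k-1)n`. -/
def LtX {k m n : ℕ} (α : F) (Ak : Matrix (Fin m) (Fin n) F)
    (X12 : Matrix (Fin m) (Fin (k - 1) × Fin n) F)
    (R : Matrix (Fin (k - 1) × Fin n) (Fin (k - 1) × Fin n) F) :
    Matrix (Fin m ⊕ (Fin (k - 1) × Fin n)) (Fin k × Fin n) F :=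
  Matrix.of fun s q =>
    Sum.elim
      (fun r => if h : (q.1 : ℕ) = 0 then α * Ak r q.2
        else X12 r (⟨(q.1 : ℕ) - 1, by have := q.1.isLt; omega⟩, q.2))
      (fun p => if h : (q.1 : ℕ) = 0 then 0
        else -R p (⟨(q.1 : ℕ) - 1, by have := q.1.isLt; omega⟩, q.2)) s

/-- Constant coefficient of the trimmed pencil `L̂_t(λ)`:
`[[Y₁₁, α A₀],[R̃, 0]]` with row split `m + (k-1)n`. -/
def LtY {k m n : ℕ} (α : F) (A0 : Matrix (Fin m) (Fin n) F)
    (Y11 : Matrix (Fin m) (Fin (k - 1) × Fin n) F)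
    (R : Matrix (Fin (k - 1) × Fin n) (Fin (k - 1) × Fin n) F) :
    Matrix (Fin m ⊕ (Fin (k - 1) × Fin n)) (Fin k × Fin n) F :=
  Matrix.of fun s q =>
    Sum.elim
      (fun r => if h : (q.1 : ℕ) < k - 1 then Y11 r (⟨(q.1 : ℕ), h⟩, q.2)
        else α * A0 r q.2)
      (fun p => if h : (q.1 : ℕ) < k - 1 then R p (⟨(q.1 : ℕ), h⟩, q.2) else 0) s

/-! ### trimming -/

/-- The rows `[0 ∣ Q₂*] (M ⊗ I_m)`. -/
def bottomRows {k m n c : ℕ} (M : Matrix (Fin k) (Fin k) F)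
    (Q : Matrix (Fin (k - 1) × Fin m) ((Fin (k - 1) × Fin n) ⊕ Fin c) F) :
    Matrix (Fin c) (Fin k × Fin m) F :=
  (Matrix.of fun (j : Fin c) (p : Fin k × Fin m) =>
      if h : (p.1 : ℕ) = 0 then 0
      else star (Q (⟨(p.1 : ℕ) - 1, by have := p.1.isLt; omega⟩, p.2) (Sum.inr j)))
    * kronId M

/-- The square matrix `[D ; [0 ∣ Q₂*](M ⊗ I_m)]` whose invertibility makes `D` admissible. -/
def trimAux {k m n c : ℕ} (M : Matrix (Fin k) (Fin k) F)
    (Q : Matrix (Fin (k - 1) × Fin m) ((Fin (k - 1) × Fin n) ⊕ Fin c) F)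
    (D : Matrix (Fin m ⊕ (Fin (k - 1) × Fin n)) (Fin k × Fin m) F) :
    Matrix ((Fin m ⊕ (Fin (k - 1) × Fin n)) ⊕ Fin c) (Fin k × Fin m) F :=
  Matrix.of (Sum.elim (fun i j => D i j) (fun i j => bottomRows M Q i j))

/-- The columns `(M̂ᵀ ⊗ I_n) [0 ; Q₂]`. -/
def rightCols {k m n c : ℕ} (M : Matrix (Fin k) (Fin k) F)
    (Q : Matrix (Fin (k - 1) × Fin n) ((Fin (k - 1) × Fin m) ⊕ Fin c) F) :
    Matrix (Fin k × Fin n) (Fin c) F :=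
  kronId Mᵀ *
    (Matrix.of fun (q : Fin k × Fin n) (j : Fin c) =>
      if h : (q.1 : ℕ) = 0 then 0
      else Q (⟨(q.1 : ℕ) - 1, by have := q.1.isLt; omega⟩, q.2) (Sum.inr j))

/-- The square matrix `[D̂ ∣ (M̂ᵀ ⊗ I_n)[0 ; Q₂]]` whose invertibility makes `D̂` admissible. -/
def trimAux2 {k m n c : ℕ} (M : Matrix (Fin k) (Fin k) F)
    (Q : Matrix (Fin (k - 1) × Fin n) ((Fin (k - 1) × Fin m) ⊕ Fin c) F)
    (D : Matrix (Fin k × Fin n) (Fin n ⊕ (Fin (k - 1) × Fin m)) F) :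
    Matrix (Fin k × Fin n) ((Fin n ⊕ (Fin (k - 1) × Fin m)) ⊕ Fin c) F :=
  Matrix.of fun q s => Sum.elim (fun t => D q t) (fun j => rightCols M Q q j) s

/-! ### minimal bases containing prescribed constant vectors -/

lemma polyVecDeg_const {γ : Type*} [Fintype γ] (u : γ → F) :
    polyVecDeg (fun p => Polynomial.C (u p)) = 0 := by
  simp [polyVecDeg]

/-- Clearing denominators: every rational vector has a nonzero polynomial multiple. -/
lemma exists_polyVec_eq_smul {γ : Type*} [Finite γ] (x : γ → RatFunc F) :
    ∃ (p : γ → F[X]) (a : (RatFunc F)ˣ), polyVec p = a • x := by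
  obtain ⟨b, hb⟩ := IsLocalization.exist_integer_multiples_of_finite (nonZeroDivisors F[X]) x
  choose p hp using hb
  have hb0 : algebraMap F[X] (RatFunc F) b ≠ 0 :=
    IsFractionRing.to_map_ne_zero_of_mem_nonZeroDivisors b.2
  refine ⟨p, Units.mk0 _ hb0, funext fun i => ?_⟩
  rw [polyVec, hp i, Algebra.smul_def]
  rfl

lemma exists_isPolyBasis {γ : Type*} [Fintype γ]
    (V : Submodule (RatFunc F) (γ → RatFunc F)) :
    ∃ (d : ℕ) (b : Fin d → γ → F[X]), IsPolyBasis V b := by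
  have B := Module.finBasis (RatFunc F) V
  choose p a hp using fun i => exists_polyVec_eq_smul (B i : γ → RatFunc F)
  have hB : LinearIndependent (RatFunc F) (fun i => (B i : γ → RatFunc F)) :=
    B.linearIndependent.map' V.subtype V.ker_subtype
  have hli : LinearIndependent (RatFunc F) (fun i => polyVec (p i)) := by
    have := hB.units_smul a
    convert this using 1
    exact funext hp
  refine ⟨_, p, hli, ?_⟩
  apply Submodule.eq_of_le_of_finrank_eq
  · rw [Submodule.span_le]
    rintro _ ⟨i, rfl⟩
    simp only [hp, SetLike.mem_coe]
    exact V.smul_mem _ (B i).2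
  · rw [finrank_span_eq_card hli, Fintype.card_fin]

lemma exists_isMinimalBasis {γ : Type*} [Fintype γ]
    (V : Submodule (RatFunc F) (γ → RatFunc F)) :
    ∃ (d : ℕ) (b : Fin d → γ → F[X]), IsMinimalBasis V b := by
  classical
  have h : ∃ s d, ∃ b : Fin d → γ → F[X], IsPolyBasis V b ∧ ∑ i, polyVecDeg (b i) = s := by
    obtain ⟨d, b, hb⟩ := exists_isPolyBasis V
    exact ⟨_, d, b, hb, rfl⟩
  obtain ⟨d, b, hb, hs⟩ := Nat.find_spec h
  refine ⟨d, b, hb, fun d' b' hb' => ?_⟩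
  rw [hs]
  exact Nat.find_min' h ⟨d', b', hb', rfl⟩

/-- Linearly independent constant vectors of `V` are part of a minimal basis of `V`:
exchange them into any minimal basis, which does not increase the order. -/
lemma exists_isMinimalBasis_append_const {γ : Type*} [Fintype γ]
    (V : Submodule (RatFunc F) (γ → RatFunc F)) {a c : ℕ} (u : Fin c → γ → F)
    (hu : LinearIndependent (RatFunc F) (fun j => polyVec fun p => Polynomial.C (u j p)))
    (huV : ∀ j, polyVec (fun p => Polynomial.C (u j p)) ∈ V)
    (hdim : Module.finrank (RatFunc F) V = a + c) :
    ∃ y : Fin a → γ → F[X],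
      IsMinimalBasis V (Fin.append y fun j => fun p => Polynomial.C (u j p)) := by
  classical
  obtain ⟨d, b, ⟨hbli, hbspan⟩, hbmin⟩ := exists_isMinimalBasis V
  set w : Fin d ⊕ Fin c → γ → F[X] := Sum.elim b fun j p => Polynomial.C (u j p) with hw
  have hwV : ∀ i, polyVec (w i) ∈ V := by
    rintro (i | j)
    · rw [← hbspan]
      exact Submodule.subset_span ⟨i, rfl⟩
    · exact huV j
  have hinr : LinearIndepOn (RatFunc F) (fun i => polyVec (w i)) (Set.range Sum.inr) :=
    (linearIndepOn_range_iff Sum.inr_injective _).2 hu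
  obtain ⟨B, -, hB, hBspan, hBli⟩ :=
    exists_linearIndepOn_extension hinr (Set.subset_univ _)
  have hspanB : Submodule.span (RatFunc F) ((fun i => polyVec (w i)) '' B) = V := by
    apply le_antisymm
    · rw [Submodule.span_le]
      rintro _ ⟨i, -, rfl⟩
      exact hwV i
    · rw [← hbspan, Submodule.span_le]
      rintro _ ⟨i, rfl⟩
      exact hBspan ⟨Sum.inl i, trivial, rfl⟩
  have hcardB : Fintype.card B = a + c := by
    rw [← hdim, ← hspanB, Set.image_eq_range, finrank_span_eq_card hBli]
  let S := {i : Fin d // Sum.inl i ∈ B}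
  let toB : S ⊕ Fin c → B :=
    Sum.elim (fun i => ⟨Sum.inl i.1, i.2⟩) (fun j => ⟨Sum.inr j, hB ⟨j, rfl⟩⟩)
  have htoB : Function.Bijective toB := by
    constructor
    · rintro (i | i) (j | j) h
      · simpa [toB, ← Subtype.ext_iff] using h
      · simp [toB] at h
      · simp [toB] at h
      · simpa [toB] using h
    · rintro ⟨i | j, h⟩
      · exact ⟨Sum.inl ⟨i, h⟩, rfl⟩
      · exact ⟨Sum.inr j, rfl⟩
  have hcardS : Fintype.card S = a := by
    have := Fintype.card_of_bijective htoB
    rw [Fintype.card_sum, Fintype.card_fin, hcardB] at this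
    omega
  let e : Fin a ≃ S := (Fintype.equivFinOfCardEq hcardS).symm
  let g : Fin (a + c) ≃ B :=
    (finSumFinEquiv.symm.trans (e.sumCongr (Equiv.refl _))).trans (Equiv.ofBijective toB htoB)
  have hg : (fun i => w (g i)) =
      Fin.append (fun i => b (e i)) fun j => fun p => Polynomial.C (u j p) := by
    funext i
    refine Fin.addCases (fun i => ?_) (fun j => ?_) i
    · simp [g, toB, w]
    · simp [g, toB, w]
  refine ⟨fun i => b (e i), ⟨⟨?_, ?_⟩, fun d' b' hb' => le_trans ?_ (hbmin d' b' hb')⟩⟩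
  · rw [← hg]
    exact LinearIndependent.comp hBli g g.injective
  · rw [← hg, ← hspanB, Set.image_eq_range]
    congr 1
    exact g.surjective.range_comp (fun i : B => polyVec (w i))
  · rw [Fin.sum_univ_add]
    simp only [Fin.append_left, Fin.append_right, polyVecDeg_const, Finset.sum_const_zero,
      add_zero]
    let f : Fin a ↪ Fin d := e.toEmbedding.trans (Function.Embedding.subtype _)
    exact (Finset.sum_map Finset.univ f fun i => polyVecDeg (b i)).symm.trans_le
      (Finset.sum_le_sum_of_subset (Finset.subset_univ _))

/-! ### extension of scalars for injective matrices -/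

lemma mulVec_map_injective {K K' ρ γ : Type*} [Field K] [Field K'] [Fintype ρ] [Fintype γ]
    [DecidableEq ρ] [DecidableEq γ] (f : K →+* K') {B : Matrix ρ γ K}
    (hB : Function.Injective B.mulVec) : Function.Injective (B.map f).mulVec := by
  obtain ⟨g, hg⟩ := LinearMap.exists_leftInverse_of_injective B.mulVecLin
    (LinearMap.ker_eq_bot.2 hB)
  have h : LinearMap.toMatrix' g * B = 1 := by
    apply Matrix.toLin'.injective
    rw [Matrix.toLin'_mul, Matrix.toLin'_toMatrix', Matrix.toLin'_one]
    exact hg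
  have h' : (LinearMap.toMatrix' g).map f * B.map f = 1 := by
    rw [← Matrix.map_mul, h, Matrix.map_one _ f.map_zero f.map_one]
  intro x y hxy
  have := congrArg ((LinearMap.toMatrix' g).map f).mulVec hxy
  simpa [Matrix.mulVec_mulVec, h'] using this

lemma mulVec_injective_of_rank_eq {K ρ γ : Type*} [Field K] [Fintype γ]
    {B : Matrix ρ γ K} (hB : B.rank = Fintype.card γ) : Function.Injective B.mulVec := by
  have h := LinearMap.finrank_range_add_finrank_ker B.mulVecLin
  rw [Module.finrank_fintype_fun_eq_card] at h
  have h0 : Module.finrank K (LinearMap.ker B.mulVecLin) = 0 := by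
    rw [Matrix.rank] at hB
    omega
  exact LinearMap.ker_eq_bot.1 (Submodule.finrank_eq_zero.1 h0)

/-! ### the lower block rows of a pencil in `𝕃₁(P)` -/

/-- The last `K` block rows of `M ⊗ I_m`. -/
def tailRows {K : ℕ} (m : ℕ) (M : Matrix (Fin (K + 1)) (Fin (K + 1)) F) :
    Matrix (Fin K × Fin m) (Fin (K + 1) × Fin m) F :=
  Matrix.of fun p q => if p.2 = q.2 then M p.1.succ q.1 else 0

/-- `[I ∣ 0] - λ [0 ∣ I]`, whose kernel is spanned by the columns of `Λ ⊗ I_n`. -/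
def shiftMat (F : Type*) [RCLike F] (K n : ℕ) :
    Matrix (Fin K × Fin n) (Fin (K + 1) × Fin n) (RatFunc F) :=
  Matrix.of fun p q => if p.2 = q.2 then
    (if q.1 = p.1.castSucc then 1 else 0) - (if q.1 = p.1.succ then RatFunc.X else 0) else 0

lemma shiftMat_mulVec {K n : ℕ} (x : Fin (K + 1) × Fin n → RatFunc F) (p : Fin K × Fin n) :
    (shiftMat F K n).mulVec x p =
      x (p.1.castSucc, p.2) - RatFunc.X * x (p.1.succ, p.2) := by
  simp [shiftMat, Matrix.mulVec, dotProduct, Fintype.sum_prod_type, sub_mul, ite_mul,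
    Finset.sum_sub_distrib]

lemma shiftMat_transpose_mulVec_injective (K n : ℕ) :
    Function.Injective (shiftMat F K n)ᵀ.mulVec := by
  refine (injective_iff_map_eq_zero (shiftMat F K n)ᵀ.mulVecLin).2 fun s hs => ?_
  have key : ∀ (N : ℕ) (j : Fin K) (c : Fin n), (j : ℕ) = N → s (j, c) = 0 := by
    intro N
    induction N using Nat.strong_induction_on with
    | _ N ih =>
      intro j c hj
      have h := congrFun hs (j.castSucc, c)
      have h2 : ∑ i : Fin K, (if j.castSucc = i.succ then RatFunc.X * s (i, c) else 0) = 0 := by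
        refine Finset.sum_eq_zero fun i _ => ?_
        split_ifs with hi
        · have : (j : ℕ) = i + 1 := by simpa using congrArg Fin.val hi
          rw [ih i (by omega) i c rfl, mul_zero]
        · rfl
      rw [Matrix.mulVecLin_apply, Matrix.mulVec, dotProduct, Fintype.sum_prod_type] at h
      simpa [shiftMat, sub_mul, ite_mul, Finset.sum_sub_distrib, h2] using h
  funext p
  exact key _ p.1 p.2 rfl

lemma eq_pow_mul_of_shiftMat_mulVec_eq_zero {K n : ℕ} {x : Fin (K + 1) × Fin n → RatFunc F}
    (hx : (shiftMat F K n).mulVec x = 0) (q : Fin (K + 1)) (c : Fin n) :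
    x (q, c) = RatFunc.X ^ (K - (q : ℕ)) * x (Fin.last K, c) := by
  induction q using Fin.reverseInduction with
  | last => simp
  | cast i ih =>
    have h := congrFun hx (i, c)
    rw [shiftMat_mulVec, Pi.zero_apply, sub_eq_zero] at h
    have hi : K - (i.castSucc : ℕ) = K - (i.succ : ℕ) + 1 := by
      have := i.isLt
      simp only [Fin.val_castSucc, Fin.val_succ]
      omega
    rw [h, ih, hi]
    ring

lemma coeff_relations {K : ℕ} {a b : Fin (K + 1) → F}
    (h : ∑ q : Fin (K + 1), (Polynomial.C (a q) * X + Polynomial.C (b q)) *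
      X ^ (K - (q : ℕ)) = 0) :
    a 0 = 0 ∧ b (Fin.last K) = 0 ∧ ∀ j : Fin K, a j.succ = -b j.castSucc := by
  have hc : ∀ d : ℕ, (∑ q : Fin (K + 1), if d = K - (q : ℕ) + 1 then a q else 0) +
      (∑ q : Fin (K + 1), if d = K - (q : ℕ) then b q else 0) = 0 := by
    intro d
    have := congrArg (fun p => Polynomial.coeff p d) h
    simpa only [add_mul, mul_assoc, ← pow_succ', Finset.sum_add_distrib, Polynomial.coeff_add,
      Polynomial.finsetSum_coeff, Polynomial.coeff_C_mul_X_pow, Polynomial.coeff_zero] using this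
  have ha : ∀ (q₀ : Fin (K + 1)) (d : ℕ), d = K - (q₀ : ℕ) + 1 →
      (∑ q : Fin (K + 1), if d = K - (q : ℕ) + 1 then a q else 0) = a q₀ := by
    intro q₀ d hd
    rw [Finset.sum_eq_single q₀ (fun q _ hq => if_neg fun h' => hq (Fin.ext (by omega)))
      (by simp), if_pos hd]
  have hb : ∀ (q₀ : Fin (K + 1)) (d : ℕ), d = K - (q₀ : ℕ) →
      (∑ q : Fin (K + 1), if d = K - (q : ℕ) then b q else 0) = b q₀ := by
    intro q₀ d hd
    rw [Finset.sum_eq_single q₀ (fun q _ hq => if_neg fun h' => hq (Fin.ext (by omega)))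
      (by simp), if_pos hd]
  refine ⟨?_, ?_, fun j => ?_⟩
  · have := hc (K + 1)
    rwa [ha 0 _ (by simp), Finset.sum_eq_zero (fun q _ => if_neg (by omega)), add_zero] at this
  · have := hc 0
    rwa [hb (Fin.last K) _ (by simp), Finset.sum_eq_zero (fun q _ => if_neg (by omega)),
      zero_add] at this
  · have := hc (K - j)
    rw [ha j.succ _ (by simp; omega), hb j.castSucc _ (by simp)] at this
    exact eq_neg_of_add_eq_zero_left this

lemma map_C_mul_pencil {ρ ρ' γ : Type*} [Fintype ρ] (T : Matrix ρ' ρ F) (Xc Yc : Matrix ρ γ F) :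
    T.map Polynomial.C * pencil Xc Yc = pencil (T * Xc) (T * Yc) := by
  ext1 i j
  simp [pencil, Matrix.mul_apply, mul_add, Finset.sum_add_distrib, Finset.sum_mul, mul_assoc]

lemma tailRows_mul_vkron {K m n : ℕ} {M : Matrix (Fin (K + 1)) (Fin (K + 1)) F}
    {v : Fin (K + 1) → F} {α : F} (hM : M.mulVec v = e1 α) (P : Matrix (Fin m) (Fin n) F[X]) :
    (tailRows m M).map Polynomial.C * vkron v P = 0 := by
  ext1 p c
  have h := congrArg Polynomial.C (congrFun hM p.1.succ)
  simp only [Matrix.mulVec, dotProduct, e1, Fin.val_succ, Nat.add_eq_zero_iff, one_ne_zero,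
    and_false, if_false, map_zero, map_sum, map_mul] at h
  calc _ = (∑ i, Polynomial.C (M p.1.succ i) * Polynomial.C (v i)) * P p.2 c := by
        simp [Matrix.mul_apply, tailRows, vkron, Fintype.sum_prod_type, apply_ite Polynomial.C,
          ite_mul, Finset.sum_mul, mul_assoc]
    _ = 0 := by rw [h, zero_mul]

/-- The lower block rows of `(M ⊗ I_m) L` are `Z ([I ∣ 0] - λ [0 ∣ I])`. -/
lemma tailRows_mul_pencil {K m n : ℕ} {P : Matrix (Fin m) (Fin n) F[X]}
    {Xc Yc : Matrix (Fin (K + 1) × Fin m) (Fin (K + 1) × Fin n) F} {v : Fin (K + 1) → F}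
    (hL : RightAnsatz P (pencil Xc Yc) v)
    {M : Matrix (Fin (K + 1)) (Fin (K + 1)) F} {α : F} (hM : M.mulVec v = e1 α)
    {Z : Matrix (Fin K × Fin m) (Fin K × Fin n) F} (hZ : Zmat1 M Yc = Z) :
    (tailRows m M).map RatFunc.C * matRF (pencil Xc Yc) = Z.map RatFunc.C * shiftMat F K n := by
  set T := tailRows m M
  have h0 : pencil (T * Xc) (T * Yc) * Lam F (K + 1) n = 0 := by
    rw [← map_C_mul_pencil, Matrix.mul_assoc, hL, tailRows_mul_vkron hM]
  have hrel : ∀ p c, _ := fun p c => coeff_relations (K := K)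
    (a := fun q => (T * Xc) p (q, c)) (b := fun q => (T * Yc) p (q, c)) (by
      have h := congrFun (congrFun h0 p) c
      rw [Matrix.mul_apply, Fintype.sum_prod_type] at h
      simpa [Lam, pencil, mul_ite] using h)
  have hZY : ∀ p (j : Fin K) c, Z p (j, c) = (T * Yc) p (j.castSucc, c) :=
    fun p j c => hZ ▸ rfl
  have hT : T.map RatFunc.C * matRF (pencil Xc Yc) = matRF (pencil (T * Xc) (T * Yc)) := by
    rw [← map_C_mul_pencil, matRF, matRF, Matrix.map_mul, Matrix.map_map]
    congr 2
  rw [hT]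
  ext1 p ⟨q, c⟩
  obtain ⟨hx, hy, hxy⟩ := hrel p c
  have hA : ∑ j : Fin K, (if q = j.castSucc then RatFunc.C ((T * Yc) p (j.castSucc, c)) else 0) =
      RatFunc.C ((T * Yc) p (q, c)) := by
    induction q using Fin.lastCases with
    | last => simp [hy, (Fin.castSucc_ne_last _).symm]
    | cast i => simp
  have hB : ∑ j : Fin K, (if q = j.succ then
      RatFunc.C ((T * Yc) p (j.castSucc, c)) * RatFunc.X else 0) =
      -(RatFunc.C ((T * Xc) p (q, c)) * RatFunc.X) := by
    induction q using Fin.cases with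
    | zero => simp [hx, (Fin.succ_ne_zero _).symm]
    | succ i => simp [hxy]
  rw [Matrix.mul_apply, Fintype.sum_prod_type]
  simp only [shiftMat, Matrix.map_apply, Matrix.of_apply, mul_ite, mul_zero, mul_sub, mul_one,
    Finset.sum_ite_eq', Finset.mem_univ, if_true, Finset.sum_sub_distrib, hZY]
  rw [hA, hB]
  simp [matRF, pencil, add_comm]

/-! ### dimensions of the null spaces -/

lemma finrank_Nr_add_nrank {ρ γ : Type*} [Fintype ρ] [Fintype γ] (P : Matrix ρ γ F[X]) :
    nrank P + Module.finrank (RatFunc F) (Nr P) = Fintype.card γ := by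
  have h := LinearMap.finrank_range_add_finrank_ker (matRF P).mulVecLin
  rwa [Module.finrank_fintype_fun_eq_card] at h

lemma nrank_transpose {ρ γ : Type*} [Fintype ρ] [Fintype γ] (P : Matrix ρ γ F[X]) :
    nrank Pᵀ = nrank P :=
  Matrix.rank_transpose (matRF P)

lemma matRF_Lam_mulVec {K n : ℕ} (x : Fin n → RatFunc F) (q : Fin (K + 1)) (c : Fin n) :
    (matRF (Lam F (K + 1) n)).mulVec x (q, c) = RatFunc.X ^ (K - (q : ℕ)) * x c := by
  simp [matRF, Lam, Matrix.mulVec, dotProduct, apply_ite (algebraMap F[X] (RatFunc F)), ite_mul]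

lemma matRF_vkron_mulVec {k m n : ℕ} (v : Fin k → F) (P : Matrix (Fin m) (Fin n) F[X])
    (x : Fin n → RatFunc F) (p : Fin k × Fin m) :
    (matRF (vkron v P)).mulVec x p = RatFunc.C (v p.1) * (matRF P).mulVec x p.2 := by
  simp [matRF, vkron, Matrix.mulVec, dotProduct, Finset.mul_sum, mul_assoc]

/-- Multiplication by `Λ ⊗ I_n` identifies the right null spaces of `P` and `L`. -/
lemma Nr_pencil_eq_map {K m n : ℕ} {P : Matrix (Fin m) (Fin n) F[X]}
    {Xc Yc : Matrix (Fin (K + 1) × Fin m) (Fin (K + 1) × Fin n) F} {v : Fin (K + 1) → F}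
    (hv : v ≠ 0) (hL : RightAnsatz P (pencil Xc Yc) v)
    {M : Matrix (Fin (K + 1)) (Fin (K + 1)) F} {α : F} (hM : M.mulVec v = e1 α)
    {Z : Matrix (Fin K × Fin m) (Fin K × Fin n) F} (hZ : Zmat1 M Yc = Z)
    (hZinj : Function.Injective (Z.map RatFunc.C).mulVec) :
    Nr (pencil Xc Yc) = (Nr P).map (matRF (Lam F (K + 1) n)).mulVecLin := by
  have hLRF : matRF (pencil Xc Yc) * matRF (Lam F (K + 1) n) = matRF (vkron v P) := by
    rw [← hL, matRF, matRF, matRF, Matrix.map_mul]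
  have hPx : ∀ x, (matRF (pencil Xc Yc)).mulVec ((matRF (Lam F (K + 1) n)).mulVec x) = 0 ↔
      (matRF P).mulVec x = 0 := by
    intro x
    rw [Matrix.mulVec_mulVec, hLRF]
    constructor
    · intro h
      obtain ⟨i, hi⟩ := Function.ne_iff.1 hv
      funext r
      have := congrFun h (i, r)
      rw [matRF_vkron_mulVec] at this
      exact (mul_eq_zero.1 this).resolve_left ((_root_.map_ne_zero _).2 hi)
    · intro h
      funext p
      rw [matRF_vkron_mulVec, h]
      simp
  ext x
  constructor
  · intro hx
    have hx' : (matRF (pencil Xc Yc)).mulVec x = 0 := hx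
    have h1 : (Z.map RatFunc.C).mulVec ((shiftMat F K n).mulVec x) =
        (Z.map RatFunc.C).mulVec 0 := by
      have := congrArg ((tailRows m M).map RatFunc.C).mulVec hx'
      rw [Matrix.mulVec_mulVec, tailRows_mul_pencil hL hM hZ, ← Matrix.mulVec_mulVec,
        Matrix.mulVec_zero] at this
      rw [Matrix.mulVec_zero]
      exact this
    have h2 := eq_pow_mul_of_shiftMat_mulVec_eq_zero (hZinj h1)
    have h3 : (matRF (Lam F (K + 1) n)).mulVec (fun c => x (Fin.last K, c)) = x := by
      funext ⟨q, c⟩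
      rw [matRF_Lam_mulVec, h2 q c]
    refine ⟨fun c => x (Fin.last K, c), (hPx _).1 ?_, h3⟩
    rw [h3]
    exact hx'
  · rintro ⟨x', hx', rfl⟩
    exact (hPx x').2 hx'

lemma matRF_Lam_mulVec_injective (K n : ℕ) :
    Function.Injective (matRF (Lam F (K + 1) n)).mulVec := by
  intro x y h
  funext c
  simpa [matRF_Lam_mulVec] using congrFun h (Fin.last K, c)

/-! ### the kernel of `𝓛_v` -/

lemma tailRows_transpose_mulVec {K m : ℕ} (M : Matrix (Fin (K + 1)) (Fin (K + 1)) F)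
    (w : Fin K × Fin m → RatFunc F) (i : Fin (K + 1)) (r : Fin m) :
    ((tailRows m M).map RatFunc.C)ᵀ.mulVec w (i, r) =
      ∑ j : Fin K, RatFunc.C (M j.succ i) * w (j, r) := by
  simp [tailRows, Matrix.mulVec, dotProduct, Fintype.sum_prod_type, apply_ite RatFunc.C, ite_mul]

lemma vproj_mulVec {k m : ℕ} (v : Fin k → F) (y : Fin k × Fin m → RatFunc F) (r : Fin m) :
    (vproj v).mulVec y r = ∑ i, RatFunc.C (v i) * y (i, r) := by
  simp [vproj, Matrix.mulVec, dotProduct, Fintype.sum_prod_type, ite_mul]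

lemma ker_vproj_eq_range {K m : ℕ} {v : Fin (K + 1) → F}
    {M : Matrix (Fin (K + 1)) (Fin (K + 1)) F} (hMu : IsUnit M) {α : F} (hα : α ≠ 0)
    (hM : M.mulVec v = e1 α) :
    LinearMap.ker (vproj (m := m) v).mulVecLin =
      LinearMap.range ((tailRows m M).map RatFunc.C)ᵀ.mulVecLin := by
  have hMv : ∀ i, ∑ l, RatFunc.C (M i l) * RatFunc.C (v l) = RatFunc.C (e1 α i) := by
    intro i
    rw [← hM]
    simp [Matrix.mulVec, dotProduct]
  ext y
  constructor
  · intro hy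
    have hy' : (vproj (m := m) v).mulVec y = 0 := hy
    set z : Fin (K + 1) → Fin m → RatFunc F := fun i r => ∑ l, RatFunc.C (M⁻¹ l i) * y (l, r)
    have hyz : ∀ l r, y (l, r) = ∑ i, RatFunc.C (M i l) * z i r := by
      intro l r
      have hinv : ∀ l', ∑ i, RatFunc.C (M i l) * RatFunc.C (M⁻¹ l' i) =
          if l' = l then 1 else 0 := by
        intro l'
        have : M⁻¹ * M = 1 := Matrix.nonsing_inv_mul _ ((Matrix.isUnit_iff_isUnit_det _).1 hMu)
        have := congrArg RatFunc.C (congrFun (congrFun this l') l)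
        rw [Matrix.mul_apply, map_sum, Matrix.one_apply, apply_ite RatFunc.C] at this
        simpa [mul_comm] using this
      simp only [z, Finset.mul_sum, ← mul_assoc]
      rw [Finset.sum_comm]
      simp only [← Finset.sum_mul, hinv]
      simp
    have hz0 : ∀ r, z 0 r = 0 := by
      intro r
      have h := congrFun hy' r
      rw [vproj_mulVec] at h
      simp only [hyz, Finset.mul_sum, ← mul_assoc, Pi.zero_apply] at h
      rw [Finset.sum_comm] at h
      simp only [← Finset.sum_mul, mul_comm (RatFunc.C (v _)), hMv] at h
      rw [Fin.sum_univ_succ] at h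
      simpa [e1, hα] using h
    refine ⟨fun p => z p.1.succ p.2, funext fun ⟨l, r⟩ => ?_⟩
    rw [Matrix.mulVecLin_apply, tailRows_transpose_mulVec, hyz, Fin.sum_univ_succ, hz0, mul_zero,
      zero_add]
  · rintro ⟨w, rfl⟩
    refine funext fun r => ?_
    rw [Matrix.mulVecLin_apply, Matrix.mulVecLin_apply, vproj_mulVec]
    simp only [tailRows_transpose_mulVec, Finset.mul_sum, ← mul_assoc]
    rw [Finset.sum_comm]
    simp only [← Finset.sum_mul, mul_comm (RatFunc.C (v _)), hMv]
    simp [e1]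

lemma tailRows_transpose_mulVec_injective {K m : ℕ}
    {M : Matrix (Fin (K + 1)) (Fin (K + 1)) F} (hMu : IsUnit M) :
    Function.Injective (tailRows m M)ᵀ.mulVec := by
  refine (injective_iff_map_eq_zero (tailRows m M)ᵀ.mulVecLin).2 fun w hw => ?_
  funext ⟨j, r⟩
  have h : M.vecMul (Fin.cons 0 fun j => w (j, r)) = M.vecMul 0 := by
    rw [Matrix.zero_vecMul]
    funext i
    have := congrFun hw (i, r)
    simpa [tailRows, Matrix.mulVec, Matrix.vecMul, dotProduct, Fintype.sum_prod_type, ite_mul,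
      Fin.sum_univ_succ, mul_comm] using this
  simpa using congrFun (Matrix.vecMul_injective_iff_isUnit.2 hMu h) j.succ

/-- The kernel of `𝓛_v` on the left null space of `L` is the image of the left null space
of `Z`. -/
lemma Nl_inf_ker_vproj_eq_map {K m n : ℕ} {P : Matrix (Fin m) (Fin n) F[X]}
    {Xc Yc : Matrix (Fin (K + 1) × Fin m) (Fin (K + 1) × Fin n) F} {v : Fin (K + 1) → F}
    (hL : RightAnsatz P (pencil Xc Yc) v)
    {M : Matrix (Fin (K + 1)) (Fin (K + 1)) F} (hMu : IsUnit M) {α : F} (hα : α ≠ 0)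
    (hM : M.mulVec v = e1 α) {Z : Matrix (Fin K × Fin m) (Fin K × Fin n) F}
    (hZ : Zmat1 M Yc = Z) :
    Nl (pencil Xc Yc) ⊓ LinearMap.ker (vproj v).mulVecLin =
      (LinearMap.ker (Z.map RatFunc.C)ᵀ.mulVecLin).map
        ((tailRows m M).map RatFunc.C)ᵀ.mulVecLin := by
  have hw : ∀ w : Fin K × Fin m → RatFunc F,
      (matRF (pencil Xc Yc))ᵀ.mulVec (((tailRows m M).map RatFunc.C)ᵀ.mulVec w) = 0 ↔
        (Z.map RatFunc.C)ᵀ.mulVec w = 0 := by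
    intro w
    rw [Matrix.mulVec_mulVec, ← Matrix.transpose_mul, tailRows_mul_pencil hL hM hZ,
      Matrix.transpose_mul, ← Matrix.mulVec_mulVec]
    constructor
    · intro h
      exact shiftMat_transpose_mulVec_injective K n (h.trans (Matrix.mulVec_zero _).symm)
    · intro h
      exact (congrArg _ h).trans (Matrix.mulVec_zero _)
  rw [ker_vproj_eq_range hMu hα hM]
  ext y
  constructor
  · rintro ⟨hy, w, rfl⟩
    exact ⟨w, (hw w).1 hy, rfl⟩
  · rintro ⟨w, h, rfl⟩
    exact ⟨(hw w).2 h, w, rfl⟩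

/-- If `Z` has full column rank, then `𝓛_v` has a kernel basis of constant vectors. -/
lemma exists_const_basis_ker {K m n : ℕ} {P : Matrix (Fin m) (Fin n) F[X]}
    {Xc Yc : Matrix (Fin (K + 1) × Fin m) (Fin (K + 1) × Fin n) F} {v : Fin (K + 1) → F}
    (hL : RightAnsatz P (pencil Xc Yc) v)
    {M : Matrix (Fin (K + 1)) (Fin (K + 1)) F} (hMu : IsUnit M) {α : F} (hα : α ≠ 0)
    (hM : M.mulVec v = e1 α) {Z : Matrix (Fin K × Fin m) (Fin K × Fin n) F}
    (hZM : Zmat1 M Yc = Z) (hZ : Z.rank = K * n) :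
    ∃ u : Fin (K * (m - n)) → (Fin (K + 1) × Fin m → F),
      LinearIndependent (RatFunc F) (fun j => polyVec fun p => Polynomial.C (u j p)) ∧
      Submodule.span (RatFunc F)
          (Set.range fun j => polyVec fun p => Polynomial.C (u j p)) =
        Nl (pencil Xc Yc) ⊓ LinearMap.ker (vproj v).mulVecLin := by
  have hdim : ∀ {R : Type _} [Field R] (B : Matrix (Fin K × Fin m) (Fin K × Fin n) R),
      B.rank = K * n → Module.finrank R (LinearMap.ker Bᵀ.mulVecLin) = K * (m - n) := by
    intro R _ B hB
    have h := LinearMap.finrank_range_add_finrank_ker Bᵀ.mulVecLin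
    rw [Module.finrank_fintype_fun_eq_card, ← Matrix.rank, Matrix.rank_transpose, hB] at h
    simp only [Fintype.card_prod, Fintype.card_fin] at h
    rw [Nat.mul_sub]
    omega
  have hZinj : Function.Injective Z.mulVec := mulVec_injective_of_rank_eq (by simpa using hZ)
  have hZr : (Z.map RatFunc.C).rank = K * n := by
    rw [Matrix.rank, LinearMap.finrank_range_of_inj (mulVec_map_injective RatFunc.C hZinj)]
    simp
  let B := Module.finBasisOfFinrankEq F _ (hdim Z hZ)
  let W : Matrix (Fin K × Fin m) (Fin (K * (m - n))) F := Matrix.of fun p j => (B j : _ → F) p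
  have hW : Function.Injective W.mulVec :=
    Matrix.mulVec_injective_iff.2
      (B.linearIndependent.map' (Submodule.subtype _) (Submodule.ker_subtype _))
  have hU : Function.Injective ((tailRows m M)ᵀ * W).mulVec := by
    intro x y h
    simp only [← Matrix.mulVec_mulVec] at h
    exact hW (tailRows_transpose_mulVec_injective hMu h)
  have hpoly : (fun j => polyVec fun p => Polynomial.C (((tailRows m M)ᵀ * W) p j)) =
      (((tailRows m M)ᵀ * W).map RatFunc.C).col := by
    funext j p
    exact RatFunc.algebraMap_C _
  have hli := Matrix.mulVec_injective_iff.1 (mulVec_map_injective RatFunc.C hU)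
  refine ⟨fun j p => ((tailRows m M)ᵀ * W) p j, ?_, ?_⟩
  · rwa [hpoly]
  · rw [hpoly, Nl_inf_ker_vproj_eq_map hL hMu hα hM hZM]
    apply Submodule.eq_of_le_of_finrank_le
    · rw [Submodule.span_le]
      rintro _ ⟨j, rfl⟩
      refine ⟨fun p => RatFunc.C (W p j), ?_, ?_⟩
      · have hB : Zᵀ.mulVec (fun p => W p j) = 0 := (B j).2
        refine funext fun q => ?_
        have := congrArg RatFunc.C (congrFun hB q)
        simp only [Matrix.mulVec, dotProduct, map_sum, map_mul, Pi.zero_apply, map_zero] at this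
        exact this
      · funext p
        simp only [Matrix.mulVecLin_apply, Matrix.mulVec, dotProduct, Matrix.col_apply,
          Matrix.map_apply, Matrix.mul_apply, map_sum, map_mul, Matrix.transpose_apply]
    · rw [finrank_span_eq_card hli, Fintype.card_fin, ← hdim _ hZr]
      exact Submodule.finrank_map_le _ _

/-- For `m ≥ n`, `nrank P = r`, `c = (k−1)(m−n)` and `L ∈ 𝕃₁(P)` of full
`Z`-rank with nonzero right ansatz vector `v`, there is a minimal basis of `N_l(L)` of the
form `{y₁(λ), …, y_{m−r}(λ), u_{m−r+1}, …, u_{m−r+c}}` where the `u_j` are constant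
vectors forming a basis of the kernel of `𝓛_v` (as a map on `N_l(L)`). -/
theorem statement_10 {F : Type*} [RCLike F] {k m n : ℕ} (hk : 0 < k) (hmn : n ≤ m)
    (r : ℕ) (A : Fin (k + 1) → Matrix (Fin m) (Fin n) F)
    (hr : nrank (matPoly A) = r)
    (Xc Yc : Matrix (Fin k × Fin m) (Fin k × Fin n) F)
    (v : Fin k → F) (hv : v ≠ 0)
    (hL : RightAnsatz (matPoly A) (pencil Xc Yc) v)
    (hZ : FullZrank1 Yc v) :
    ∃ (y : Fin (m - r) → (Fin k × Fin m → F[X]))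
      (u : Fin ((k - 1) * (m - n)) → (Fin k × Fin m → F)),
      IsMinimalBasis (Nl (pencil Xc Yc))
        (Fin.append y fun j => fun p => Polynomial.C (u j p)) ∧
      LinearIndependent (RatFunc F) (fun j => polyVec fun p => Polynomial.C (u j p)) ∧
      Submodule.span (RatFunc F)
          (Set.range fun j => polyVec fun p => Polynomial.C (u j p)) =
        Nl (pencil Xc Yc) ⊓ LinearMap.ker (Matrix.mulVecLin (vproj v)) := by
  obtain ⟨K, rfl⟩ : ∃ K, k = K + 1 := ⟨k - 1, by omega⟩
  obtain ⟨M, α, hMu, hα, hM, hrank⟩ := hZ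
  obtain ⟨u, huli, huspan⟩ := exists_const_basis_ker hL hMu hα hM rfl hrank
  have hZinj : Function.Injective ((Zmat1 M Yc).map RatFunc.C).mulVec :=
    mulVec_map_injective RatFunc.C (mulVec_injective_of_rank_eq (by simpa using hrank))
  have hNr : Module.finrank (RatFunc F) (Nr (pencil Xc Yc)) =
      Module.finrank (RatFunc F) (Nr (matPoly A)) := by
    rw [Nr_pencil_eq_map hv hL hM rfl hZinj]
    exact (Submodule.equivMapOfInjective _ (matRF_Lam_mulVec_injective K n) _).symm.finrank_eq
  have hdim : Module.finrank (RatFunc F) (Nl (pencil Xc Yc)) = (m - r) + K * (m - n) := by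
    have h1 := finrank_Nr_add_nrank (matPoly A)
    have h2 := finrank_Nr_add_nrank (pencil Xc Yc)
    have h3 := finrank_Nr_add_nrank (pencil Xc Yc)ᵀ
    have h4 : r ≤ m := hr ▸ Matrix.rank_le_height _
    rw [nrank_transpose] at h3
    simp only [Fintype.card_prod, Fintype.card_fin, Nat.add_mul, one_mul] at h1 h2 h3
    have h5 : K * n ≤ K * m := Nat.mul_le_mul_left K hmn
    rw [Nl, Nat.mul_sub]
    omega
  obtain ⟨y, hy⟩ := exists_isMinimalBasis_append_const (Nl (pencil Xc Yc)) u huli (fun j => by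
    have : polyVec (fun p => Polynomial.C (u j p)) ∈
        Nl (pencil Xc Yc) ⊓ LinearMap.ker (Matrix.mulVecLin (vproj v)) :=
      huspan ▸ Submodule.subset_span ⟨j, rfl⟩
    exact this.1) hdim
  exact ⟨y, u, hy, huli, huspan⟩
end GLin
end
end

section
/- Let P(λ) be an m×n matrix polynomial of grade k with m ≥ n, and let L(λ) ∈ 𝕃₁(P) with nonzero right ansatz vector v ∈ F^k have full Z-rank. Let r = nrank P(λ), c = (k−1)(m−n), and 𝓛_v(y(λ)) = (v^T⊗I_m)y(λ) for y(λ) ∈ N_l(L). If β = {y₁(λ), …, y_{m−r}(λ), u_{m−r+1}, …, u_{m−r+c}} is a minimal basis of N_l(L) in which {u_{m−r+1}, …, u_{m−r+c}} is a basis of the kernel of 𝓛_v, then {𝓛_v(y₁(λ)), …, 𝓛_v(y_{m−r}(λ))} is a minimal basis of N_l(P). Moreover, if δ₁ ≥ δ₂ ≥ … ≥ δ_{m−r} ≥ 0 = 0 = … = 0 (with c trailing zeros) are the left minimal indices of L(λ), then δ₁ ≥ δ₂ ≥ … ≥ δ_{m−r} are the left minimal indices of P(λ). -/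
noncomputable section

open Polynomial Matrix

namespace GLin

variable {F : Type*} [RCLike F]

/-! ### Degrees of vector polynomials -/

theorem polyVecDeg_le_iff {γ : Type*} [Fintype γ] {x : γ → F[X]} {D : ℕ} :
    polyVecDeg x ≤ D ↔ ∀ i, (x i).natDegree ≤ D := by
  simp [polyVecDeg]

theorem natDegree_sum_C_mul_le {ι : Type*} [Fintype ι] (a : ι → F) (x : ι → F[X]) {D : ℕ}
    (hx : ∀ i, (x i).natDegree ≤ D) : (∑ i, C (a i) * x i).natDegree ≤ D :=
  natDegree_sum_le_of_forall_le _ _ fun i _ => (natDegree_C_mul_le _ _).trans (hx i)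

theorem polyVecDeg_LvPoly_le {k m : ℕ} (v : Fin k → F) (y : Fin k × Fin m → F[X]) :
    polyVecDeg (LvPoly v y) ≤ polyVecDeg y :=
  polyVecDeg_le_iff.2 fun r =>
    natDegree_sum_C_mul_le v (fun i => y (i, r)) fun i => polyVecDeg_le_iff.1 le_rfl (i, r)

theorem polyVecDeg_C {γ : Type*} [Fintype γ] (u : γ → F) :
    polyVecDeg (fun p => C (u p)) = 0 :=
  Nat.le_zero.1 (polyVecDeg_le_iff.2 fun _ => by simp)

/-! ### Polynomial bases and exchange -/

section Bases

variable {γ : Type*} [Fintype γ] {V : Submodule (RatFunc F) (γ → RatFunc F)}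

theorem IsPolyBasis.mem {ι : Type*} {b : ι → γ → F[X]} (hb : IsPolyBasis V b) (i : ι) :
    polyVec (b i) ∈ V :=
  hb.2 ▸ Submodule.subset_span ⟨i, rfl⟩

theorem IsPolyBasis.finrank_eq {ι : Type*} [Fintype ι] {b : ι → γ → F[X]}
    (hb : IsPolyBasis V b) : Module.finrank (RatFunc F) V = Fintype.card ι := by
  rw [← hb.2, finrank_span_eq_card hb.1]

/-- Linearly independent vector polynomials in `V`, as many as the dimension of `V`, form a
polynomial basis. -/
theorem isPolyBasis_of_card_eq {ι : Type*} [Fintype ι] {b : ι → γ → F[X]}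
    (hli : LinearIndependent (RatFunc F) fun i => polyVec (b i))
    (hmem : ∀ i, polyVec (b i) ∈ V) (hcard : Fintype.card ι = Module.finrank (RatFunc F) V) :
    IsPolyBasis V b := by
  refine ⟨hli, Submodule.eq_of_le_of_finrank_eq ?_ ?_⟩
  · rw [Submodule.span_le]
    rintro _ ⟨i, rfl⟩
    exact hmem i
  · rw [finrank_span_eq_card hli, hcard]

/-- A vector polynomial of degree at most `d` is spanned by the elements of degree at most `d`
of any minimal basis. -/
theorem IsMinimalBasis.mem_span_of_deg_le {N : ℕ} {b : Fin N → γ → F[X]}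
    (hb : IsMinimalBasis V b) {z : γ → F[X]} (hz : polyVec z ∈ V) {d : ℕ}
    (hd : polyVecDeg z ≤ d) :
    polyVec z ∈ Submodule.span (RatFunc F)
      (Set.range fun i : {i // polyVecDeg (b i) ≤ d} => polyVec (b i)) := by
  obtain ⟨a, ha⟩ := (Submodule.mem_span_range_iff_exists_fun _).1 (hb.1.2.symm ▸ hz)
  rw [← ha]
  refine Submodule.sum_mem _ fun i _ => ?_
  by_cases hi : polyVecDeg (b i) ≤ d
  · exact Submodule.smul_mem _ _ (Submodule.subset_span ⟨⟨i, hi⟩, rfl⟩)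
  have hai : a i = 0 := by
    by_contra hne
    have hupd : (fun j => polyVec (Function.update b i z j)) =
        Function.update (fun j => polyVec (b j)) i (polyVec z) := by
      ext1 j
      exact Function.apply_update (fun _ => polyVec) b i z j
    have hbasis : IsPolyBasis V (Function.update b i z) := by
      refine isPolyBasis_of_card_eq ?_ (fun j => ?_) hb.1.finrank_eq.symm
      · rw [hupd]
        refine hb.1.1.update i _ ⟨1, one_mem _, Finsupp.equivFunOnFinite.symm a, ?_, ?_⟩
        · simpa using hne
        · rw [one_smul, ← ha, Finsupp.linearCombination_apply, Finsupp.sum_fintype _ _ (by simp)]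
          simp
      · rcases eq_or_ne j i with rfl | hj
        · simpa using hz
        · simpa [hj] using hb.1.mem j
    refine (hb.2 N _ hbasis).not_gt (Finset.sum_lt_sum (fun j _ => ?_) ⟨i, Finset.mem_univ i, ?_⟩)
    · rcases eq_or_ne j i with rfl | hj
      · simpa using by omega
      · simp [hj]
    · simpa using by omega
  simp [hai]

theorem IsMinimalBasis.card_deg_le {N N' : ℕ} {b : Fin N → γ → F[X]} {b' : Fin N' → γ → F[X]}
    (hb : IsMinimalBasis V b) (hb' : IsPolyBasis V b') (d : ℕ) :
    Fintype.card {i // polyVecDeg (b' i) ≤ d} ≤ Fintype.card {i // polyVecDeg (b i) ≤ d} := by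
  have hli' : LinearIndependent (RatFunc F)
      fun i : {i // polyVecDeg (b' i) ≤ d} => polyVec (b' i) :=
    hb'.1.comp _ Subtype.val_injective
  have hli : LinearIndependent (RatFunc F)
      fun i : {i // polyVecDeg (b i) ≤ d} => polyVec (b i) :=
    hb.1.1.comp _ Subtype.val_injective
  rw [← finrank_span_eq_card hli', ← finrank_span_eq_card hli]
  refine Submodule.finrank_mono (Submodule.span_le.2 ?_)
  rintro _ ⟨i, rfl⟩
  exact hb.mem_span_of_deg_le (hb'.mem i) i.2

end Bases

theorem card_le_succ_fiber {κ : Type*} [Fintype κ] (f : κ → ℕ) (d : ℕ) :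
    Fintype.card {i // f i ≤ d + 1} =
      Fintype.card {i // f i ≤ d} + Fintype.card {i // f i = d + 1} := by
  rw [← Fintype.card_subtype_or_disjoint]
  · exact Fintype.card_congr (Equiv.subtypeEquivRight fun i => by omega)
  · rw [Pi.disjoint_iff]
    intro i
    rw [Prop.disjoint_iff]
    omega

/-- Families of natural numbers with equal counting functions `d ↦ #{i | f i ≤ d}` are equal up
to reindexing. -/
theorem exists_equiv_of_card_le_eq {ι ι' : Type*} [Fintype ι] [Fintype ι'] {f : ι → ℕ}
    {g : ι' → ℕ} (h : ∀ d, Fintype.card {i // f i ≤ d} = Fintype.card {i // g i ≤ d}) :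
    ∃ σ : ι ≃ ι', ∀ i, g (σ i) = f i := by
  have hfib : ∀ d, Fintype.card {i // f i = d} = Fintype.card {i // g i = d} := by
    rintro (_ | d)
    · simpa using h 0
    · have h1 := h (d + 1)
      rw [card_le_succ_fiber, card_le_succ_fiber, h d] at h1
      omega
  exact ⟨Equiv.ofFiberEquiv fun d => Fintype.equivOfCardEq (hfib d),
    fun i => Equiv.ofFiberEquiv_map _ i⟩

theorem card_append_zero_le {a c : ℕ} (f : Fin a → ℕ) (d : ℕ) :
    Fintype.card {i // Fin.append f (fun _ : Fin c => 0) i ≤ d} =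
      Fintype.card {i // f i ≤ d} + c := by
  simp only [Fintype.card_subtype, Finset.card_filter, Fin.sum_univ_add, Fin.append_left,
    Fin.append_right]
  simp

/-! ### Lifting left null vectors -/

/-- If `∑ g_q λ^{K-q} = 0`, then `g` is the product of a row vector `h` with the pencil
`[I ∣ 0] - λ [0 ∣ I]`, the degree of `h` being one less than that of `g`. -/
theorem exists_row_factor {K D : ℕ} (g : Fin (K + 1) → F[X])
    (hg : ∑ q, g q * X ^ (K - (q : ℕ)) = 0) (hdeg : ∀ q, (g q).natDegree ≤ D + 1) :
    ∃ h : ℕ → F[X], h 0 = 0 ∧ h (K + 1) = 0 ∧ (∀ q ≤ K + 1, (h q).natDegree ≤ D) ∧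
      ∀ q : Fin (K + 1), g q = h (q + 1) - X * h q := by
  let g' : ℕ → F[X] := fun q => if hq : q < K + 1 then g ⟨q, hq⟩ else 0
  have hg' : ∀ q : Fin (K + 1), g' q = g q := fun q => dif_pos q.2
  let h : ℕ → F[X] := fun q => ∑ i ∈ Finset.range q, g' i * X ^ (q - 1 - i)
  have hsucc : ∀ q, h (q + 1) = g' q + X * h q := by
    intro q
    simp only [h, Finset.sum_range_succ, Finset.mul_sum]
    rw [add_comm]
    congr 1
    · simp
    · refine Finset.sum_congr rfl fun i hi => ?_
      have hi := Finset.mem_range.1 hi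
      rw [show q + 1 - 1 - i = (q - 1 - i) + 1 by omega, pow_succ]
      ring
  have hlast : h (K + 1) = 0 := by
    simp only [h]
    rw [Finset.sum_range, ← hg]
    exact Finset.sum_congr rfl fun q _ => by rw [hg', Nat.add_sub_cancel]
  refine ⟨h, by simp [h], hlast, fun q hq => ?_, fun q => ?_⟩
  · induction hq using Nat.decreasingInduction with
    | self => simp [hlast]
    | of_succ q hq ih =>
      by_cases h0 : h q = 0
      · simp [h0]
      have hX : X * h q = h (q + 1) - g' q := by rw [hsucc]; ring
      have := natDegree_sub_le_of_le (ih.trans D.le_succ) ((hg' ⟨q, hq⟩).symm ▸ hdeg ⟨q, hq⟩)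
      rw [← hX, natDegree_X_mul h0] at this
      simpa using this
  · rw [hsucc, hg']
    ring

theorem exists_left_inverse_of_rank_eq_card {ρ γ : Type*} [Fintype ρ] [Fintype γ]
    [DecidableEq γ] [DecidableEq ρ] (Z : Matrix ρ γ F) (h : Z.rank = Fintype.card γ) :
    ∃ B : Matrix γ ρ F, B * Z = 1 := by
  rw [← vecMul_surjective_iff_exists_left_inverse]
  have hr : LinearMap.range Zᵀ.mulVecLin = ⊤ := by
    apply Submodule.eq_top_of_finrank_eq
    rw [Module.finrank_fintype_fun_eq_card, ← h, ← rank_transpose]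
    rfl
  intro x
  obtain ⟨w, hw⟩ := LinearMap.range_eq_top.1 hr x
  exact ⟨w, by simpa [mulVec_transpose] using hw⟩

theorem sum_left_inverse_mul {ρ γ : Type*} [Fintype ρ] [Fintype γ] [DecidableEq γ]
    {Z : Matrix ρ γ F} {B : Matrix γ ρ F} (hB : B * Z = 1) (x : γ → F[X]) (q : γ) :
    ∑ i, (∑ p, C (-B p i) * x p) * C (Z i q) = -x q := by
  have key : ∀ p, ∑ i, B p i * Z i q = if p = q then 1 else 0 := by
    intro p
    have := congrFun (congrFun hB p) q
    rwa [mul_apply, one_apply] at this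
  calc ∑ i, (∑ p, C (-B p i) * x p) * C (Z i q)
      = ∑ p, -C (∑ i, B p i * Z i q) * x p := by
        simp only [map_sum, Finset.sum_mul, ← Finset.sum_neg_distrib]
        rw [Finset.sum_comm]
        exact Finset.sum_congr rfl fun p _ => Finset.sum_congr rfl fun i _ => by
          rw [C_neg, C_mul]
          ring
    _ = -x q := by
        simp only [key]
        simp [apply_ite C]

theorem kronId_mul_apply {k m : ℕ} {γ : Type*} (M : Matrix (Fin k) (Fin k) F)
    (Yc : Matrix (Fin k × Fin m) γ F) (i : Fin k) (r : Fin m) (q : γ) :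
    (kronId (m := m) M * Yc) (i, r) q = ∑ j, M i j * Yc (j, r) q := by
  rw [Matrix.mul_apply, Fintype.sum_prod_type]
  simp [kronId]

/-- Every polynomial left null vector of `P` lifts through `𝓛_v` to a polynomial left null
vector of `L` of no larger degree. -/
theorem exists_lift_left_null {K m n : ℕ} (P : Matrix (Fin m) (Fin n) F[X])
    (Xc Yc : Matrix (Fin (K + 1) × Fin m) (Fin (K + 1) × Fin n) F) (v : Fin (K + 1) → F)
    (hL : RightAnsatz P (pencil Xc Yc) v) (hZ : FullZrank1 Yc v)
    (z : Fin m → F[X]) (hz : z ᵥ* P = 0) :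
    ∃ y : Fin (K + 1) × Fin m → F[X], y ᵥ* pencil Xc Yc = 0 ∧ LvPoly v y = z ∧
      polyVecDeg y ≤ polyVecDeg z := by
  obtain ⟨M, α, -, hα, hMv, hrank⟩ := hZ
  obtain ⟨Z, B, hB, hZM⟩ : ∃ (Z : Matrix (Fin K × Fin m) (Fin K × Fin n) F)
      (B : Matrix (Fin K × Fin n) (Fin K × Fin m) F), B * Z = 1 ∧ ∀ i r q s,
        Z (i, r) (q, s) = ∑ j, M i.succ j * Yc (j, r) (q.castSucc, s) := by
    obtain ⟨B, hB⟩ := exists_left_inverse_of_rank_eq_card (Zmat1 M Yc) (by simp [hrank])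
    exact ⟨Zmat1 M Yc, B, hB, fun i r q s => kronId_mul_apply M Yc i.succ r (q.castSucc, s)⟩
  set D := polyVecDeg z
  have hzdeg : ∀ r, (z r).natDegree ≤ D := polyVecDeg_le_iff.1 le_rfl
  -- the transformed pencil `(M ⊗ I_m) L`
  let xx : Fin (K + 1) → Fin m → Fin (K + 1) → Fin n → F :=
    fun i r q s => ∑ j, M i j * Xc (j, r) (q, s)
  let yy : Fin (K + 1) → Fin m → Fin (K + 1) → Fin n → F :=
    fun i r q s => ∑ j, M i j * Yc (j, r) (q, s)
  let T : Fin (K + 1) → Fin m → Fin (K + 1) → Fin n → F[X] :=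
    fun i r q s => ∑ j, C (M i j) * pencil Xc Yc (j, r) (q, s)
  have hT : ∀ i r q s, T i r q s = C (xx i r q s) * X + C (yy i r q s) := by
    intro i r q s
    simp only [T, xx, yy, pencil, of_apply, map_sum, map_mul, Finset.sum_mul,
      ← Finset.sum_add_distrib]
    exact Finset.sum_congr rfl fun j _ => by ring
  have hTdeg : ∀ i r q s, (T i r q s).natDegree ≤ 1 := by
    intro i r q s
    rw [hT]
    exact natDegree_linear_le
  have hLrow : ∀ j r s, ∑ q, pencil Xc Yc (j, r) (q, s) * X ^ (K - (q : ℕ)) =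
      C (v j) * P r s := by
    intro j r s
    have := congrFun (congrFun hL (j, r)) s
    simpa [mul_apply, Lam, vkron, Fintype.sum_prod_type] using this
  have hTrow : ∀ i r s, ∑ q, T i r q s * X ^ (K - (q : ℕ)) =
      C (e1 (k := K + 1) α i) * P r s := by
    intro i r s
    simp only [T, Finset.sum_mul]
    rw [Finset.sum_comm, ← hMv]
    simp only [mulVec, dotProduct, map_sum, map_mul, Finset.sum_mul, mul_assoc,
      ← Finset.mul_sum, hLrow]
  -- the rows below the first block factor through the `Z`-matrix
  have hbot : ∀ (i : Fin K) r s, ∃ f : ℕ → F[X], f 0 = 0 ∧ f (K + 1) = 0 ∧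
      (∀ q : Fin K, f (q + 1) = C (Z (i, r) (q, s))) ∧
      ∀ q : Fin (K + 1), T i.succ r q s = f (q + 1) - X * f q := by
    intro i r s
    obtain ⟨f, hf0, hfK, hfdeg, hf⟩ := exists_row_factor (D := 0) (fun q => T i.succ r q s)
      (by rw [hTrow]; simp [e1]) (fun q => hTdeg _ _ _ _)
    refine ⟨f, hf0, hfK, fun q => ?_, hf⟩
    have h0 := congrArg (fun p => coeff p 0) (hf q.castSucc)
    simp only [hT] at h0
    rw [eq_C_of_natDegree_le_zero (hfdeg (q + 1) (by omega)), hZM]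
    exact congrArg C (by simpa using h0.symm)
  choose f hf0 hfK hfZ hf using hbot
  -- the contribution of the first block row
  let g : Fin n → Fin (K + 1) → F[X] := fun s q => ∑ r, C α⁻¹ * z r * T 0 r q s
  have hgsum : ∀ s, ∑ q, g s q * X ^ (K - (q : ℕ)) = 0 := by
    intro s
    have hzs : ∑ r, z r * P r s = 0 := congrFun hz s
    simp only [g, Finset.sum_mul]
    rw [Finset.sum_comm]
    simp only [mul_assoc, ← Finset.mul_sum, hTrow]
    have he : e1 (k := K + 1) α 0 = α := by simp [e1]
    simp only [he, mul_left_comm _ (C α), ← Finset.mul_sum, hzs, mul_zero]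
  have hgdeg : ∀ s q, (g s q).natDegree ≤ D + 1 := by
    intro s q
    refine natDegree_sum_le_of_forall_le _ _ fun r _ => ?_
    exact natDegree_mul_le_of_le ((natDegree_C_mul_le _ _).trans (hzdeg r)) (hTdeg _ _ _ _)
  choose h hh0 hhK hhdeg hh using fun s => exists_row_factor (g s) (hgsum s) (hgdeg s)
  let w₂ : Fin K → Fin m → F[X] :=
    fun i r => ∑ p : Fin K × Fin n, C (-B p (i, r)) * h p.2 (p.1 + 1)
  have hw₂deg : ∀ i r, (w₂ i r).natDegree ≤ D := fun i r =>
    natDegree_sum_C_mul_le (fun p => -B p (i, r)) (fun p : Fin K × Fin n => h p.2 (p.1 + 1))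
      fun p => hhdeg _ _ (by omega)
  have hw₂Z : ∀ (q : Fin K) s, ∑ i, ∑ r, w₂ i r * C (Z (i, r) (q, s)) =
      -h s (q + 1) := by
    intro q s
    rw [← sum_left_inverse_mul hB (fun p : Fin K × Fin n => h p.2 (p.1 + 1)) (q, s)]
    exact (Fintype.sum_prod_type fun x : Fin K × Fin m =>
      w₂ x.1 x.2 * C (Z x (q, s))).symm
  have hw₂f : ∀ q ≤ K + 1, ∀ s, ∑ i, ∑ r, w₂ i r * f i r s q = -h s q := by
    intro q hq s
    rcases Nat.eq_zero_or_pos q with rfl | hpos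
    · simp [hf0, hh0]
    · obtain ⟨q, rfl⟩ := Nat.exists_eq_succ_of_ne_zero hpos.ne'
      rcases Nat.lt_or_ge q K with hqK | hqK
      · simpa only [hfZ _ _ _ ⟨q, hqK⟩] using hw₂Z ⟨q, hqK⟩ s
      · obtain rfl : q = K := by omega
        simp [hfK, hhK]
  let w : Fin (K + 1) → Fin m → F[X] := Fin.cons (fun r => C α⁻¹ * z r) w₂
  have hwdeg : ∀ i r, (w i r).natDegree ≤ D := by
    intro i r
    cases i using Fin.cases with
    | zero => exact (natDegree_C_mul_le _ _).trans (hzdeg r)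
    | succ i => exact hw₂deg i r
  have hwT : ∀ q s, ∑ i, ∑ r, w i r * T i r q s = 0 := by
    intro q s
    rw [Fin.sum_univ_succ]
    have h2 : ∑ i, ∑ r, w (Fin.succ i) r * T i.succ r q s = -h s (q + 1) + X * h s q := by
      have h3 := hw₂f (q + 1) (by omega) s
      have h4 := hw₂f q (by omega) s
      simp only [w, Fin.cons_succ, hf, mul_sub, Finset.sum_sub_distrib, h3, mul_left_comm _ X,
        ← Finset.mul_sum, h4]
      ring
    have h1 : ∑ r, w 0 r * T 0 r q s = h s (q + 1) - X * h s q := hh s q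
    rw [h1, h2]
    ring
  refine ⟨fun p => ∑ i, C (M i p.1) * w i p.2, ?_, ?_, ?_⟩
  · ext1 ⟨q, s⟩
    rw [Pi.zero_apply, ← hwT q s]
    simp only [vecMul, dotProduct, Fintype.sum_prod_type, T, Finset.sum_mul, Finset.mul_sum]
    rw [Finset.sum_comm, Finset.sum_comm (s := Finset.univ (α := Fin (K + 1)))
      (t := Finset.univ (α := Fin m))]
    refine Finset.sum_congr rfl fun r _ => ?_
    rw [Finset.sum_comm]
    exact Finset.sum_congr rfl fun i _ => Finset.sum_congr rfl fun j _ => by ring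
  · ext1 r
    have hsum : LvPoly v (fun p => ∑ i, C (M i p.1) * w i p.2) r =
        ∑ i, C ((M *ᵥ v) i) * w i r := by
      simp only [LvPoly, mulVec, dotProduct, map_sum, map_mul, Finset.mul_sum, Finset.sum_mul]
      rw [Finset.sum_comm]
      exact Finset.sum_congr rfl fun i _ => Finset.sum_congr rfl fun j _ => by ring
    rw [hsum, hMv, Fin.sum_univ_succ]
    simp [e1, w, ← mul_assoc, ← C_mul, hα]
  · exact polyVecDeg_le_iff.2 fun p =>
      natDegree_sum_C_mul_le (fun i => M i p.1) (fun i => w i p.2) fun i => hwdeg i p.2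

/-! ### Null spaces -/

theorem polyVec_mem_Nl {ρ γ : Type*} [Fintype ρ] {P : Matrix ρ γ F[X]} {z : ρ → F[X]} :
    polyVec z ∈ Nl P ↔ z ᵥ* P = 0 := by
  have hcoord : ∀ j, (matRF Pᵀ *ᵥ polyVec z) j = algebraMap F[X] (RatFunc F) ((z ᵥ* P) j) := by
    intro j
    simp [matRF, polyVec, mulVec, vecMul, dotProduct, mul_comm]
  simp only [Nl, Nr, LinearMap.mem_ker, mulVecLin_apply, funext_iff, hcoord, Pi.zero_apply,
    map_eq_zero_iff _ (RatFunc.algebraMap_injective F)]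

theorem finrank_Nl {m n : ℕ} (P : Matrix (Fin m) (Fin n) F[X]) :
    Module.finrank (RatFunc F) (Nl P) = m - nrank P := by
  have h := LinearMap.finrank_range_add_finrank_ker (matRF Pᵀ).mulVecLin
  have hrank : Module.finrank (RatFunc F) (LinearMap.range (matRF Pᵀ).mulVecLin) = nrank P := by
    rw [nrank, ← rank_transpose]
    rfl
  rw [hrank, Module.finrank_fintype_fun_eq_card, Fintype.card_fin] at h
  change Module.finrank (RatFunc F) (LinearMap.ker (matRF Pᵀ).mulVecLin) = _
  omega

theorem mulVecLin_vproj_polyVec {k m : ℕ} (v : Fin k → F) (y : Fin k × Fin m → F[X]) :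
    (vproj v).mulVecLin (polyVec y) = polyVec (LvPoly v y) := by
  ext1 r
  simp [vproj, polyVec, LvPoly, mulVec, dotProduct, Fintype.sum_prod_type]

theorem LvPoly_vecMul_eq_zero {k m n : ℕ} {P : Matrix (Fin m) (Fin n) F[X]}
    {L : Matrix (Fin k × Fin m) (Fin k × Fin n) F[X]} {v : Fin k → F} (hL : RightAnsatz P L v)
    {y : Fin k × Fin m → F[X]} (hy : y ᵥ* L = 0) : LvPoly v y ᵥ* P = 0 := by
  have h : LvPoly v y ᵥ* P = y ᵥ* vkron v P := by
    ext1 s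
    simp only [vecMul, dotProduct, LvPoly, vkron, of_apply, Fintype.sum_prod_type,
      Finset.sum_mul]
    rw [Finset.sum_comm]
    exact Finset.sum_congr rfl fun i _ => Finset.sum_congr rfl fun r _ => by ring
  rw [h, ← hL, ← vecMul_vecMul, hy, zero_vecMul]

theorem polyVec_append {γ : Type*} {a c : ℕ} (y : Fin a → γ → F[X]) (u : Fin c → γ → F[X]) :
    (fun i => polyVec (Fin.append y u i)) ∘ finSumFinEquiv =
      Sum.elim (fun i => polyVec (y i)) (fun j => polyVec (u j)) := by
  ext1 (i | j) <;> simp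

theorem sum_polyVecDeg_append_C {γ : Type*} [Fintype γ] {a c : ℕ} (y : Fin a → γ → F[X])
    (u : Fin c → γ → F) :
    ∑ i, polyVecDeg (Fin.append y (fun j p => C (u j p)) i) = ∑ i, polyVecDeg (y i) := by
  simp [Fin.sum_univ_add, polyVecDeg_C]

/-- The order of the non-kernel part of a minimal basis of `N_l(L)` is at most that of any
polynomial basis of `N_l(P)`. -/
theorem sum_deg_le_of_isPolyBasis {K m n a c d : ℕ} {P : Matrix (Fin m) (Fin n) F[X]}
    {Xc Yc : Matrix (Fin (K + 1) × Fin m) (Fin (K + 1) × Fin n) F} {v : Fin (K + 1) → F}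
    (hL : RightAnsatz P (pencil Xc Yc) v) (hZ : FullZrank1 Yc v)
    {y : Fin a → Fin (K + 1) × Fin m → F[X]} {u : Fin c → Fin (K + 1) × Fin m → F}
    (hβ : IsMinimalBasis (Nl (pencil Xc Yc)) (Fin.append y fun j p => C (u j p)))
    (hu₁ : LinearIndependent (RatFunc F) fun j => polyVec fun p => C (u j p))
    (hu₂ : Submodule.span (RatFunc F) (Set.range fun j => polyVec fun p => C (u j p)) =
      Nl (pencil Xc Yc) ⊓ LinearMap.ker (vproj v).mulVecLin)
    (ha : Module.finrank (RatFunc F) (Nl P) = a)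
    {b : Fin d → Fin m → F[X]} (hb : IsPolyBasis (Nl P) b) :
    ∑ i, polyVecDeg (y i) ≤ ∑ i, polyVecDeg (b i) := by
  obtain rfl : d = a := by rw [← ha, hb.finrank_eq, Fintype.card_fin]
  choose x hx hxb hxdeg using fun i =>
    exists_lift_left_null P Xc Yc v hL hZ (b i) (polyVec_mem_Nl.1 (hb.mem i))
  have hmap : (vproj v).mulVecLin ∘ (fun i => polyVec (x i)) = fun i => polyVec (b i) := by
    ext1 i
    rw [Function.comp_apply, mulVecLin_vproj_polyVec, hxb]
  have hli : LinearIndependent (RatFunc F)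
      ((vproj v).mulVecLin ∘ fun i => polyVec (x i)) := hmap ▸ hb.1
  have hbasis : IsPolyBasis (Nl (pencil Xc Yc)) (Fin.append x fun j p => C (u j p)) := by
    refine isPolyBasis_of_card_eq ?_ (fun i => ?_) hβ.1.finrank_eq.symm
    · rw [← linearIndependent_equiv finSumFinEquiv, polyVec_append]
      refine hli.of_comp.sum_type hu₁ ((Submodule.range_ker_disjoint hli).mono_right ?_)
      exact hu₂.le.trans inf_le_right
    · cases i using Fin.addCases with
      | left i => simpa using polyVec_mem_Nl.2 (hx i)
      | right j => simpa using hβ.1.mem (Fin.natAdd d j)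
  have hle := hβ.2 _ _ hbasis
  rw [sum_polyVecDeg_append_C, sum_polyVecDeg_append_C] at hle
  exact hle.trans (Finset.sum_le_sum fun i _ => hxdeg i)

/-- The images under `𝓛_v` of the non-kernel part of a basis of `N_l(L)` form a basis of
`N_l(P)`. -/
theorem isPolyBasis_LvPoly {k m n a c : ℕ} {P : Matrix (Fin m) (Fin n) F[X]}
    {L : Matrix (Fin k × Fin m) (Fin k × Fin n) F[X]} {v : Fin k → F}
    (hL : RightAnsatz P L v)
    {y : Fin a → Fin k × Fin m → F[X]} {u : Fin c → Fin k × Fin m → F[X]}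
    (hβ : IsPolyBasis (Nl L) (Fin.append y u))
    (hu : Submodule.span (RatFunc F) (Set.range fun j => polyVec (u j)) =
      Nl L ⊓ LinearMap.ker (vproj v).mulVecLin)
    (ha : Module.finrank (RatFunc F) (Nl P) = a) :
    IsPolyBasis (Nl P) fun i => LvPoly v (y i) := by
  have hy : ∀ i, polyVec (y i) ∈ Nl L := fun i => by simpa using hβ.mem (Fin.castAdd c i)
  refine isPolyBasis_of_card_eq ?_
    (fun i => polyVec_mem_Nl.2 (LvPoly_vecMul_eq_zero hL (polyVec_mem_Nl.1 (hy i)))) (by simp [ha])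
  have hli := hβ.1
  rw [← linearIndependent_equiv finSumFinEquiv, polyVec_append] at hli
  obtain ⟨hliy, -, hdisj⟩ := linearIndependent_sum.1 hli
  have hspan : Submodule.span (RatFunc F) (Set.range fun i => polyVec (y i)) ≤ Nl L := by
    rw [Submodule.span_le]
    rintro _ ⟨i, rfl⟩
    exact hy i
  have hker : Disjoint (Submodule.span (RatFunc F) (Set.range fun i => polyVec (y i)))
      (LinearMap.ker (vproj v).mulVecLin) := by
    rw [Submodule.disjoint_def] at hdisj ⊢
    exact fun x hx hx' => hdisj x hx (hu.ge ⟨hspan hx, hx'⟩)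
  have hmap := LinearIndependent.map (v := fun i => polyVec (y i)) hliy hker
  simpa only [Function.comp_def, mulVecLin_vproj_polyVec] using hmap


/-- For `m ≥ n`, `nrank P = r`, `c = (k−1)(m−n)` and `L ∈ 𝕃₁(P)` of full
`Z`-rank with nonzero right ansatz vector `v`: if
`β = {y₁(λ), …, y_{m−r}(λ), u_{m−r+1}, …, u_{m−r+c}}` is a minimal basis of `N_l(L)` in
which the constant vectors `u_j` form a basis of the kernel of `𝓛_v`, then
`{𝓛_v(y₁(λ)), …, 𝓛_v(y_{m−r}(λ))}` is a minimal basis of `N_l(P)`; moreover if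
`δ₁ ≥ … ≥ δ_{m−r} ≥ 0 = ⋯ = 0` (with `c` trailing zeros) are the left minimal indices of
`L`, then `δ₁ ≥ … ≥ δ_{m−r}` are the left minimal indices of `P`. -/
theorem statement_11 {F : Type*} [RCLike F] {k m n : ℕ} (hk : 0 < k) (hmn : n ≤ m)
    (r : ℕ) (A : Fin (k + 1) → Matrix (Fin m) (Fin n) F)
    (hr : nrank (matPoly A) = r)
    (Xc Yc : Matrix (Fin k × Fin m) (Fin k × Fin n) F)
    (v : Fin k → F) (hv : v ≠ 0)
    (hL : RightAnsatz (matPoly A) (pencil Xc Yc) v)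
    (hZ : FullZrank1 Yc v)
    (y : Fin (m - r) → (Fin k × Fin m → F[X]))
    (u : Fin ((k - 1) * (m - n)) → (Fin k × Fin m → F))
    (hβ : IsMinimalBasis (Nl (pencil Xc Yc))
      (Fin.append y fun j => fun p => Polynomial.C (u j p)))
    (hu₁ : LinearIndependent (RatFunc F) fun j => polyVec fun p => Polynomial.C (u j p))
    (hu₂ : Submodule.span (RatFunc F)
        (Set.range fun j => polyVec fun p => Polynomial.C (u j p)) =
      Nl (pencil Xc Yc) ⊓ LinearMap.ker (Matrix.mulVecLin (vproj v))) :
    IsMinimalBasis (Nl (matPoly A)) (fun i => LvPoly v (y i)) ∧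
    (∀ δ : Fin (m - r) → ℕ, Antitone δ →
      HasMinIndices (Nl (pencil Xc Yc))
          (Fin.append δ fun _ : Fin ((k - 1) * (m - n)) => 0) →
        HasMinIndices (Nl (matPoly A)) δ) := by
  obtain ⟨K, rfl⟩ := Nat.exists_eq_succ_of_ne_zero hk.ne'
  have ha : Module.finrank (RatFunc F) (Nl (matPoly A)) = m - r := hr ▸ finrank_Nl _
  have hbasis : IsPolyBasis (Nl (matPoly A)) fun i => LvPoly v (y i) :=
    isPolyBasis_LvPoly hL hβ.1 hu₂ ha
  have hsum : ∀ (d : ℕ) (b : Fin d → Fin m → F[X]), IsPolyBasis (Nl (matPoly A)) b →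
      ∑ i, polyVecDeg (y i) ≤ ∑ i, polyVecDeg (b i) := fun d b hb =>
    sum_deg_le_of_isPolyBasis hL hZ hβ hu₁ hu₂ ha hb
  have hle : ∀ i ∈ Finset.univ, polyVecDeg (LvPoly v (y i)) ≤ polyVecDeg (y i) :=
    fun i _ => polyVecDeg_LvPoly_le v (y i)
  refine ⟨⟨hbasis, fun d b hb => (Finset.sum_le_sum hle).trans (hsum d b hb)⟩, ?_⟩
  rintro δ - ⟨b, hb, hbδ⟩
  have hdeg : ∀ i, polyVecDeg (LvPoly v (y i)) = polyVecDeg (y i) := fun i =>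
    (Finset.sum_eq_sum_iff_of_le hle).1
      ((Finset.sum_le_sum hle).antisymm (hsum _ _ hbasis)) i (Finset.mem_univ i)
  have hβdeg : (fun i => polyVecDeg (Fin.append y (fun j p => C (u j p)) i)) =
      Fin.append (fun i => polyVecDeg (y i)) fun _ => 0 := by
    ext1 i
    cases i using Fin.addCases <;> simp [polyVecDeg_C]
  obtain ⟨σ, hσ⟩ : ∃ σ : Fin (m - r) ≃ Fin (m - r), ∀ i, polyVecDeg (y (σ i)) = δ i := by
    refine exists_equiv_of_card_le_eq (g := fun i => polyVecDeg (y i)) fun d => ?_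
    have h := (hβ.card_deg_le hb.1 d).antisymm (hb.card_deg_le hβ.1 d)
    simp only [hbδ, congrFun hβdeg] at h
    rw [card_append_zero_le, card_append_zero_le] at h
    exact Nat.add_right_cancel h
  refine ⟨fun i => LvPoly v (y (σ i)), ⟨⟨hbasis.1.comp σ σ.injective, ?_⟩, fun d b hb => ?_⟩,
    fun i => (hdeg _).trans (hσ i)⟩
  · rw [← hbasis.2]
    exact congrArg _ (σ.surjective.range_comp fun i => polyVec (LvPoly v (y i)))
  · rw [σ.sum_comp fun i => polyVecDeg (LvPoly v (y i))]
    exact (Finset.sum_le_sum hle).trans (hsum d b hb)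
end GLin
end
end
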